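/- Let w = s_{i_L}⋯s_{i_1} be a reduced word in the Weyl group W of A whose letters i_1,…,i_L are the first L terms of ι, and let D_L(∞) be the subset of ℤ^∞_ι obtained from {0̄} by successively closing under the powers of f̃_{i_1}, …, f̃_{i_L}. Then D_L(∞) = { x ∈ F(∞) : x_k = 0 for all k > L }. (This is the polyhedral description of the image of the crystal B_w(∞) under the Kashiwara embedding Ψ_ι.) -/

import Mathlib

noncomputable section

namespace PaperNakashima

variable {I : Type*} [DecidableEq I]

/-- `σ_k(x) = x_k + Σ_{j>k} a_{i_k i_j} x_j`. -/
def sig (A : I → I → ℤ) (ι : ℕ → I) (k : ℕ) (x : ℕ →₀ ℤ) : ℤ :=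
  x k + ∑ j ∈ x.support.filter (fun j => k < j), A (ι k) (ι j) * x j

/-- `σ_0^{(i)}(x) = -λ_i + Σ_{j≥1} a_{i i_j} x_j`. -/
def sig0 (A : I → I → ℤ) (ι : ℕ → I) (lam : I → ℤ) (i : I) (x : ℕ →₀ ℤ) : ℤ :=
  -lam i + ∑ j ∈ x.support.filter (fun j => 1 ≤ j), A i (ι j) * x j

/-- `σ^{(i)}(x) = max_{k ≥ 1, i_k = i} σ_k(x)`. -/
def sigMax (A : I → I → ℤ) (ι : ℕ → I) (i : I) (x : ℕ →₀ ℤ) : ℤ :=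
  sSup ((fun k => sig A ι k x) '' {k | 1 ≤ k ∧ ι k = i})

/-- `M^{(i)}(x) = {k ≥ 1 : i_k = i, σ_k(x) = σ^{(i)}(x)}`. -/
def Mset (A : I → I → ℤ) (ι : ℕ → I) (i : I) (x : ℕ →₀ ℤ) : Set ℕ :=
  {k | 1 ≤ k ∧ ι k = i ∧ sig A ι k x = sigMax A ι i x}

/-- The Kashiwara operator `f̃_i` on `ℤ^∞_ι[λ] ⊔ {0}`, with `none` playing the role of `0`. -/
def ftil (A : I → I → ℤ) (ι : ℕ → I) (lam : I → ℤ) (i : I) :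
    Option (ℕ →₀ ℤ) → Option (ℕ →₀ ℤ)
  | none => none
  | some x =>
    if sig0 A ι lam i x < sigMax A ι i x then
      some (x + Finsupp.single (sInf (Mset A ι i x)) 1)
    else none

/-- The Kashiwara operator `ẽ_i` on `ℤ^∞_ι[λ] ⊔ {0}`. -/
def etil (A : I → I → ℤ) (ι : ℕ → I) (lam : I → ℤ) (i : I) :
    Option (ℕ →₀ ℤ) → Option (ℕ →₀ ℤ)
  | none => none
  | some x =>
    if 0 < sigMax A ι i x ∧ sig0 A ι lam i x ≤ sigMax A ι i x then
      some (x - Finsupp.single (sSup (Mset A ι i x)) 1)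
    else none

/-- `ε_i(x) = max(σ^{(i)}(x), σ_0^{(i)}(x))`. -/
def eps (A : I → I → ℤ) (ι : ℕ → I) (lam : I → ℤ) (i : I) (x : ℕ →₀ ℤ) : ℤ :=
  max (sigMax A ι i x) (sig0 A ι lam i x)

/-- `φ_i(x) = ε_i(x) - σ_0^{(i)}(x) = ⟨h_i, wt(x)⟩ + ε_i(x)`. -/
def phi (A : I → I → ℤ) (ι : ℕ → I) (lam : I → ℤ) (i : I) (x : ℕ →₀ ℤ) : ℤ :=
  eps A ι lam i x - sig0 A ι lam i x

/-- `F(λ)`: the image of `B(λ)` under the Kashiwara embedding, i.e. all nonzero elements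
obtained from the highest weight element `0̄` by applying Kashiwara operators `f̃`. -/
def FSet (A : I → I → ℤ) (ι : ℕ → I) (lam : I → ℤ) : Set (ℕ →₀ ℤ) :=
  {x | ∃ l : List I, List.foldl (fun y i => ftil A ι lam i y) (some 0) l = some x}

/-- The Demazure subsets `D_k`: `D_0 = {0̄}` and
`D_k = { f̃_{i_k}^m(x) : m ≥ 0, x ∈ D_{k-1} } \ {0}`. -/
def Dem (A : I → I → ℤ) (ι : ℕ → I) (lam : I → ℤ) : ℕ → Set (ℕ →₀ ℤ)
  | 0 => {0}
  | (k+1) => {y | ∃ m : ℕ, ∃ x ∈ Dem A ι lam k,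
      (ftil A ι lam (ι (k+1)))^[m] (some x) = some y}

/-- The Coxeter matrix entry attached to a generalized Cartan matrix:
`m_{ij} = 2, 3, 4, 6, ∞(=0)` according as `a_{ij} a_{ji} = 0, 1, 2, 3, ≥ 4`. -/
def coxEntry (A : I → I → ℤ) (i j : I) : ℕ :=
  if i = j then 1
  else if A i j * A j i = 0 then 2
  else if A i j * A j i = 1 then 3
  else if A i j * A j i = 2 then 4
  else if A i j * A j i = 3 then 6
  else 0

/-- The Coxeter matrix of the Weyl group of a generalized Cartan matrix `A`. -/
def coxOf (A : I → I → ℤ) : CoxeterMatrix I where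
  M := Matrix.of fun i j => coxEntry A i j
  isSymm := by
    ext i j
    by_cases h : i = j
    · simp [coxEntry, h]
    · simp only [Matrix.transpose_apply, Matrix.of_apply, coxEntry, if_neg h,
        if_neg (Ne.symm h), mul_comm (A i j) (A j i)]
  diagonal i := by simp [coxEntry]
  off_diagonal i j h := by
    simp only [Matrix.of_apply, coxEntry, if_neg h]
    split_ifs <;> decide

/-- The word `i_L, i_{L-1}, …, i_1` (the first `L` letters of `ι`, read backwards). -/
def demWord (ι : ℕ → I) (L : ℕ) : List I :=
  (List.range L).map (fun k => ι (L - k))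

/-- The Kashiwara operator `f̃_i` on `ℤ^∞_ι` (the `B(∞)` version, which is never `0`):
add `1` to the entry at position `min M^{(i)}(x)`. -/
def ftilInf (A : I → I → ℤ) (ι : ℕ → I) (i : I) (x : ℕ →₀ ℤ) : ℕ →₀ ℤ :=
  x + Finsupp.single (sInf (Mset A ι i x)) 1

/-- `F(∞)`: the image of `B(∞)` under the Kashiwara embedding `Ψ_ι`, i.e. all elements
obtained from `0̄` by applying the operators `f̃`. -/
def FInf (A : I → I → ℤ) (ι : ℕ → I) : Set (ℕ →₀ ℤ) :=
  {x | ∃ l : List I, List.foldl (fun y i => ftilInf A ι i y) 0 l = x}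

/-- The Demazure subsets `D_k(∞)`: `D_0(∞) = {0̄}` and
`D_k(∞) = { f̃_{i_k}^m(x) : m ≥ 0, x ∈ D_{k-1}(∞) }`. -/
def DemInf (A : I → I → ℤ) (ι : ℕ → I) : ℕ → Set (ℕ →₀ ℤ)
  | 0 => {0}
  | (k+1) => {y | ∃ m : ℕ, ∃ x ∈ DemInf A ι k, (ftilInf A ι (ι (k+1)))^[m] x = y}

section General

variable {S : Type*}

/-- `Σ_{j ≥ K} a_{i i_j} x_j`. -/
def tailSum (A : S → S → ℤ) (ι : ℕ → S) (i : S) (K : ℕ) (x : ℕ →₀ ℤ) : ℤ :=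
  x.sum fun j v => if K ≤ j then A i (ι j) * v else 0

/-- `max_{k ≥ K, i_k = i} σ_k(x)`. -/
def tailMax (A : S → S → ℤ) (ι : ℕ → S) (K : ℕ) (i : S) (x : ℕ →₀ ℤ) : ℤ :=
  sSup ((fun k => sig A ι k x) '' {k | K ≤ k ∧ ι k = i})

/-- `f̃_i`, restricted to positions `≥ K`, acts on `x` at position `k`. -/
structure ActsAt (A : S → S → ℤ) (ι : ℕ → S) (K : ℕ) (i : S) (x : ℕ →₀ ℤ) (k : ℕ) : Prop where
  le : K ≤ k
  color : ι k = i
  max : ∀ j, K ≤ j → ι j = i → sig A ι j x ≤ sig A ι k x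
  first : ∀ j, K ≤ j → j < k → ι j = i → sig A ι j x < sig A ι k x

variable {A : S → S → ℤ} {ι : ℕ → S}

lemma tailSum_add (i : S) (K : ℕ) (x y : ℕ →₀ ℤ) :
    tailSum A ι i K (x + y) = tailSum A ι i K x + tailSum A ι i K y := by
  unfold tailSum
  apply Finsupp.sum_add_index'
  · intro j; split_ifs <;> simp
  · intro j u v; split_ifs <;> ring

@[simp] lemma tailSum_zero (i : S) (K : ℕ) : tailSum A ι i K 0 = 0 := by
  simp [tailSum]

lemma tailSum_single (i : S) (K p : ℕ) (t : ℤ) :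
    tailSum A ι i K (Finsupp.single p t) = if K ≤ p then A i (ι p) * t else 0 := by
  unfold tailSum
  rw [Finsupp.sum_single_index]
  split_ifs <;> simp

lemma tailSum_succ (i : S) (K : ℕ) (x : ℕ →₀ ℤ) :
    tailSum A ι i K x = A i (ι K) * x K + tailSum A ι i (K + 1) x := by
  induction x using Finsupp.induction_linear with
  | zero => simp
  | add f g hf hg => rw [tailSum_add, tailSum_add, hf, hg, Finsupp.add_apply]; ring
  | single p t =>
    rw [tailSum_single, tailSum_single, Finsupp.single_apply]
    rcases lt_trichotomy p K with h | h | h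
    · rw [if_neg (by omega), if_neg (by omega), if_neg (by omega)]; simp
    · subst h; simp
    · rw [if_pos (by omega), if_neg (by omega), if_pos (by omega)]; simp

lemma tailSum_congr (i : S) (K : ℕ) {x y : ℕ →₀ ℤ} (h : ∀ j, K ≤ j → x j = y j) :
    tailSum A ι i K x = tailSum A ι i K y := by
  have key : tailSum A ι i K (x - y) = 0 := by
    unfold tailSum
    apply Finset.sum_eq_zero
    intro j _
    dsimp only
    split_ifs with hj
    · simp [h j hj]
    · rfl
  have := tailSum_add (A := A) (ι := ι) i K (x - y) y
  rw [sub_add_cancel, key, zero_add] at this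
  exact this

lemma tailSum_eq_zero (i : S) (K : ℕ) {x : ℕ →₀ ℤ} (h : ∀ j, K ≤ j → x j = 0) :
    tailSum A ι i K x = 0 := by
  rw [tailSum_congr i K (y := 0) (by simpa using h), tailSum_zero]

lemma sig_eq (k : ℕ) (x : ℕ →₀ ℤ) : sig A ι k x = x k + tailSum A ι (ι k) (k + 1) x := by
  unfold sig tailSum Finsupp.sum
  rw [Finset.sum_filter]
  rfl

lemma sig_zero (k : ℕ) : sig A ι k 0 = 0 := by simp [sig_eq]

lemma sig_congr (k : ℕ) {x y : ℕ →₀ ℤ} (h : ∀ j, k ≤ j → x j = y j) :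
    sig A ι k x = sig A ι k y := by
  rw [sig_eq, sig_eq, h k le_rfl, tailSum_congr _ _ fun j hj => h j (by omega)]

lemma sig_add (k : ℕ) (x y : ℕ →₀ ℤ) : sig A ι k (x + y) = sig A ι k x + sig A ι k y := by
  simp only [sig_eq, tailSum_add, Finsupp.add_apply]; ring

lemma sig_single (k p : ℕ) (t : ℤ) : sig A ι k (Finsupp.single p t) =
    if k = p then t else if k < p then A (ι k) (ι p) * t else 0 := by
  rw [sig_eq, tailSum_single, Finsupp.single_apply]
  rcases lt_trichotomy p k with h | h | h
  · rw [if_neg (by omega), if_neg (by omega), if_neg (by omega), if_neg (by omega)]; simp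
  · subst h; simp
  · rw [if_neg (by omega), if_pos (by omega), if_neg (by omega), if_pos (by omega)]; simp

lemma sig_of_large {x : ℕ →₀ ℤ} {N : ℕ} (hN : ∀ j, N ≤ j → x j = 0) {k : ℕ} (hk : N ≤ k) :
    sig A ι k x = 0 := by
  rw [sig_eq, hN k hk, tailSum_eq_zero _ _ fun j hj => hN j (by omega), add_zero]

lemma exists_bound (x : ℕ →₀ ℤ) : ∃ N, ∀ j, N ≤ j → x j = 0 := by
  refine ⟨x.support.sup id + 1, fun j hj => ?_⟩
  by_contra h
  have : id j ≤ x.support.sup id := Finset.le_sup (Finsupp.mem_support_iff.mpr h)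
  simp at this; omega

lemma exists_color_ge (hι : ∀ i : S, {k : ℕ | 1 ≤ k ∧ ι k = i}.Infinite) (i : S) (N : ℕ) :
    ∃ k, N ≤ k ∧ ι k = i := by
  obtain ⟨k, hk, hN⟩ := (hι i).exists_gt N
  exact ⟨k, hN.le, hk.2⟩

lemma exists_actsAt (hι : ∀ i : S, {k : ℕ | 1 ≤ k ∧ ι k = i}.Infinite) (K : ℕ) (i : S)
    (x : ℕ →₀ ℤ) : ∃ k, ActsAt A ι K i x k := by
  classical
  obtain ⟨N, hN⟩ := exists_bound x
  obtain ⟨q, hq, hqi⟩ := exists_color_ge hι i (max K N)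
  have hmax : ∃ k, K ≤ k ∧ ι k = i ∧ ∀ j, K ≤ j → ι j = i → sig A ι j x ≤ sig A ι k x := by
    obtain ⟨k, hk, hkm⟩ := Finset.exists_max_image
      ((Finset.range (q + 1)).filter fun k => K ≤ k ∧ ι k = i) (fun k => sig A ι k x)
      ⟨q, by simp [hqi]; omega⟩
    simp only [Finset.mem_filter, Finset.mem_range] at hk hkm
    refine ⟨k, hk.2.1, hk.2.2, fun j hj hji => ?_⟩
    rcases le_or_gt j q with h | h
    · exact hkm j ⟨by omega, hj, hji⟩
    · rw [sig_of_large hN (k := j) (by omega), ← sig_of_large (A := A) (ι := ι) hN (k := q) (by omega)]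
      exact hkm q ⟨by omega, by omega, hqi⟩
  have hs := Nat.find_spec hmax
  refine ⟨Nat.find hmax, hs.1, hs.2.1, hs.2.2, fun j hj hlt hji => ?_⟩
  have hn := Nat.find_min hmax hlt
  push Not at hn
  obtain ⟨j', hj', hji', h⟩ := hn hj hji
  exact h.trans_le (hs.2.2 j' hj' hji')

lemma ActsAt.unique {K : ℕ} {i : S} {x : ℕ →₀ ℤ} {k k' : ℕ} (h : ActsAt A ι K i x k)
    (h' : ActsAt A ι K i x k') : k = k' := by
  rcases lt_trichotomy k k' with hl | hl | hl
  · exact absurd (h'.first k h.le hl h.color) (not_lt.mpr (h.max k' h'.le h'.color))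
  · exact hl
  · exact absurd (h.first k' h'.le hl h'.color) (not_lt.mpr (h'.max k h.le h.color))

lemma tailMax_eq_of {K : ℕ} {i : S} {x : ℕ →₀ ℤ} {v : ℤ}
    (h₁ : ∀ j, K ≤ j → ι j = i → sig A ι j x ≤ v) (h₂ : ∃ k, K ≤ k ∧ ι k = i ∧ sig A ι k x = v) :
    tailMax A ι K i x = v := by
  obtain ⟨k, hk, hki, rfl⟩ := h₂
  refine IsGreatest.csSup_eq ⟨⟨k, ⟨hk, hki⟩, rfl⟩, ?_⟩
  rintro _ ⟨j, ⟨hj, hji⟩, rfl⟩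
  exact h₁ j hj hji

lemma ActsAt.tailMax_eq {K : ℕ} {i : S} {x : ℕ →₀ ℤ} {k : ℕ} (h : ActsAt A ι K i x k) :
    tailMax A ι K i x = sig A ι k x :=
  tailMax_eq_of h.max ⟨k, h.le, h.color, rfl⟩

lemma sig_le_tailMax (hι : ∀ i : S, {k : ℕ | 1 ≤ k ∧ ι k = i}.Infinite) {K : ℕ} {i : S}
    (x : ℕ →₀ ℤ) {j : ℕ} (hj : K ≤ j) (hji : ι j = i) : sig A ι j x ≤ tailMax A ι K i x := by
  obtain ⟨k, hk⟩ := exists_actsAt (A := A) hι K i x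
  rw [hk.tailMax_eq]
  exact hk.max j hj hji

lemma sigMax_eq_tailMax (i : S) (x : ℕ →₀ ℤ) : sigMax A ι i x = tailMax A ι 1 i x := rfl

lemma ActsAt.ftilInf_eq {i : S} {x : ℕ →₀ ℤ} {k : ℕ} (h : ActsAt A ι 1 i x k) :
    ftilInf A ι i x = x + Finsupp.single k 1 := by
  have : sInf (Mset A ι i x) = k := by
    have hm : IsLeast (Mset A ι i x) k := by
      refine ⟨⟨h.le, h.color, by rw [sigMax_eq_tailMax, h.tailMax_eq]⟩, ?_⟩
      rintro j ⟨hj, hji, hs⟩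
      by_contra hlt
      have := h.first j hj (by omega) hji
      rw [hs, sigMax_eq_tailMax, h.tailMax_eq] at this
      exact lt_irrefl _ this
    exact hm.csInf_eq
  rw [ftilInf, this]

lemma exists_ftilInf_eq (hι : ∀ i : S, {k : ℕ | 1 ≤ k ∧ ι k = i}.Infinite) (i : S)
    (x : ℕ →₀ ℤ) : ∃ k, ActsAt A ι 1 i x k ∧ ftilInf A ι i x = x + Finsupp.single k 1 := by
  obtain ⟨k, hk⟩ := exists_actsAt (A := A) hι 1 i x
  exact ⟨k, hk, hk.ftilInf_eq⟩

end General

section RankTwo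

/-- The rank two Cartan matrix with off-diagonal entries `-a`, `-b`. -/
def cartanTwo (a b : ℤ) : Bool → Bool → ℤ
  | true, true => 2
  | true, false => -a
  | false, true => -b
  | false, false => 2

/-- The alternating word: odd positions have colour `true`. -/
def alt (k : ℕ) : Bool := decide (k % 2 = 1)

/-- The absolute value of the Cartan entry between positions `k` and `k + 1`. -/
def coefAt (a b : ℤ) (k : ℕ) : ℤ := if k % 2 = 1 then a else b

/-- Chebyshev-type sequence `1, a, ab - 1, …` (with `c_0 = 0`). -/
def cheb (a b : ℤ) : ℕ → ℤ
  | 0 => 0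
  | 1 => 1
  | k + 2 => coefAt a b (k + 1) * cheb a b (k + 1) - cheb a b k

/-- The sequence `cheb` with the two colours exchanged. -/
def chebDual (a b : ℤ) : ℕ → ℤ
  | 0 => 0
  | 1 => 1
  | k + 2 => coefAt a b k * chebDual a b (k + 1) - chebDual a b k

/-- Position `k` is smaller than the Coxeter number. -/
def Below (a b : ℤ) (k : ℕ) : Prop := ∀ j, 1 ≤ j → j ≤ k → 0 < cheb a b j ∧ 0 < chebDual a b j

variable {a b : ℤ}

lemma alt_add_two (k : ℕ) : alt (k + 2) = alt k := by simp [alt]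

lemma alt_succ (k : ℕ) : alt (k + 1) = !alt k := by
  unfold alt
  rcases Nat.mod_two_eq_zero_or_one k with h | h <;> simp [Nat.add_mod, h]

lemma coefAt_add_two (k : ℕ) : coefAt a b (k + 2) = coefAt a b k := by simp [coefAt]

@[simp] lemma cartanTwo_self (c : Bool) : cartanTwo a b c c = 2 := by cases c <;> rfl

lemma cartanTwo_alt (k : ℕ) : cartanTwo a b (alt k) (alt (k + 1)) = -coefAt a b k := by
  unfold alt coefAt
  rcases Nat.mod_two_eq_zero_or_one k with h | h <;> simp [Nat.add_mod, h, cartanTwo]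

lemma alt_infinite (c : Bool) : {k : ℕ | 1 ≤ k ∧ alt k = c}.Infinite := by
  rw [Set.infinite_iff_exists_gt]
  intro n
  cases c
  · exact ⟨2 * n + 2, ⟨by omega, by simp [alt]⟩, by omega⟩
  · exact ⟨2 * n + 1, ⟨by omega, by simp [alt]⟩, by omega⟩

lemma cheb_succ_succ (k : ℕ) :
    cheb a b (k + 2) = coefAt a b (k + 1) * cheb a b (k + 1) - cheb a b k := rfl

lemma chebDual_succ_succ (k : ℕ) :
    chebDual a b (k + 2) = coefAt a b k * chebDual a b (k + 1) - chebDual a b k := rfl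

@[simp] lemma cheb_zero : cheb a b 0 = 0 := rfl
@[simp] lemma cheb_one : cheb a b 1 = 1 := rfl
@[simp] lemma chebDual_zero : chebDual a b 0 = 0 := rfl
@[simp] lemma chebDual_one : chebDual a b 1 = 1 := rfl

lemma cheb_det (k : ℕ) :
    cheb a b (k + 1) * chebDual a b (k + 1) - chebDual a b (k + 2) * cheb a b k = 1 := by
  induction k with
  | zero => simp
  | succ k ih =>
    rw [cheb_succ_succ, chebDual_succ_succ (k + 1), ← ih]; ring

lemma chebDual_eq_cheb_swap (k : ℕ) : chebDual a b k = cheb b a k := by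
  induction k using Nat.twoStepInduction with
  | zero => rfl
  | one => rfl
  | more k h1 h2 =>
    rw [chebDual_succ_succ, cheb_succ_succ, h1, h2]
    congr 2
    unfold coefAt
    rcases Nat.mod_two_eq_zero_or_one k with h | h <;> simp [Nat.add_mod, h]

lemma cheb_pos_of_four_le (ha : 0 ≤ a) (hb : 0 ≤ b) (hab : 4 ≤ a * b) (k : ℕ) :
    0 < cheb a b (k + 1) ∧ coefAt a b k * cheb a b k ≤ 2 * cheb a b (k + 1) := by
  have ha' : 0 < a := by
    rcases ha.eq_or_lt with h | h
    · subst h; simp at hab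
    · exact h
  have hb' : 0 < b := by
    rcases hb.eq_or_lt with h | h
    · subst h; simp at hab
    · exact h
  have hpos : ∀ k, 0 < coefAt a b k := fun k => by unfold coefAt; split_ifs <;> assumption
  have hprod : ∀ k, coefAt a b k * coefAt a b (k + 1) = a * b := fun k => by
    unfold coefAt
    rcases Nat.mod_two_eq_zero_or_one k with h | h <;> simp [Nat.add_mod, h, mul_comm]
  have key : ∀ k, 0 < cheb a b (k + 1) ∧ 0 ≤ cheb a b k ∧
      coefAt a b k * cheb a b k ≤ 2 * cheb a b (k + 1) := by
    intro k
    induction k with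
    | zero => simp
    | succ k ih =>
      obtain ⟨h1, h0, h2⟩ := ih
      have e := cheb_succ_succ (a := a) (b := b) k
      have p1 := hpos (k + 1)
      have h3 : coefAt a b (k + 1) * (coefAt a b k * cheb a b k) ≤
          coefAt a b (k + 1) * (2 * cheb a b (k + 1)) := mul_le_mul_of_nonneg_left h2 p1.le
      have h4 : 4 * cheb a b k ≤ a * b * cheb a b k := mul_le_mul_of_nonneg_right hab h0
      rw [← hprod k] at h4
      have h5 : 0 < coefAt a b (k + 1) * cheb a b (k + 1) := mul_pos p1 h1
      exact ⟨by nlinarith, h1.le, by nlinarith⟩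
  exact ⟨(key k).1, (key k).2.2⟩

lemma Below.mono {j k : ℕ} (h : Below a b k) (hjk : j ≤ k) : Below a b j :=
  fun i hi hij => h i hi (hij.trans hjk)

lemma below_one : Below a b 1 := fun j h1 h2 => by
  obtain rfl : j = 1 := by omega
  simp

lemma below_zero : Below a b 0 := below_one.mono (by omega)

lemma Below.succ {k : ℕ} (h : Below a b k) (h1 : 0 < cheb a b (k + 1))
    (h2 : 0 < chebDual a b (k + 1)) : Below a b (k + 1) := fun j hj hjk => by
  rcases Nat.lt_or_ge k j with h' | h'
  · obtain rfl : j = k + 1 := by omega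
    exact ⟨h1, h2⟩
  · exact h j hj h'

lemma Below.cheb_nonneg {k : ℕ} (h : Below a b k) : 0 ≤ cheb a b k := by
  rcases k with _ | k
  · simp
  · exact (h (k + 1) (by omega) le_rfl).1.le

lemma Below.chebDual_nonneg {k : ℕ} (h : Below a b k) : 0 ≤ chebDual a b k := by
  rcases k with _ | k
  · simp
  · exact (h (k + 1) (by omega) le_rfl).2.le

/-- The rank two data: `a, b ≥ 0` and `a = 0 ↔ b = 0`. -/
structure RankTwoData (a b : ℤ) : Prop where
  a_nonneg : 0 ≤ a
  b_nonneg : 0 ≤ b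
  zero_iff : a = 0 ↔ b = 0

lemma eq_zero_of_below_not_below_aux {h k : ℕ} (h0 : cheb a b (h + 1) = 0)
    (h1 : chebDual a b (h + 1) = 0)
    (hb : Below a b h) (hk : Below a b k) (hk' : ¬Below a b (k + 1)) :
    cheb a b (k + 1) = 0 ∧ chebDual a b (k + 1) = 0 := by
  obtain rfl : k = h := by
    apply le_antisymm
    · by_contra hlt
      exact absurd (hk (h + 1) (by omega) (by omega)).1 (by omega)
    · by_contra hlt
      exact hk' (hb.mono (by omega))
  exact ⟨h0, h1⟩

lemma RankTwoData.eq_zero_of_not_below (h : RankTwoData a b) {k : ℕ} (hk : Below a b k)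
    (hk' : ¬Below a b (k + 1)) : cheb a b (k + 1) = 0 ∧ chebDual a b (k + 1) = 0 := by
  obtain ⟨ha, hb, hab⟩ := h
  rcases le_or_gt 4 (a * b) with h4 | h4
  · refine absurd (fun j hj _ => ?_) hk'
    obtain ⟨j, rfl⟩ : ∃ i, j = i + 1 := ⟨j - 1, by omega⟩
    rw [chebDual_eq_cheb_swap]
    exact ⟨(cheb_pos_of_four_le ha hb h4 j).1, (cheb_pos_of_four_le hb ha (by linarith) j).1⟩
  · by_cases h0 : a = 0
    · have h0' := hab.mp h0
      subst h0 h0'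
      exact eq_zero_of_below_not_below_aux (h := 1) (by simp [cheb, coefAt])
        (by simp [chebDual, coefAt]) below_one hk hk'
    have h0' : b ≠ 0 := fun h => h0 (hab.mpr h)
    have ha1 : 1 ≤ a := by omega
    have hb1 : 1 ≤ b := by omega
    have ha3 : a ≤ 3 := by nlinarith
    have hb3 : b ≤ 3 := by nlinarith
    have b2 : Below a b 2 := below_one.succ (by simp [cheb, coefAt]; omega)
      (by simp [chebDual, coefAt]; omega)
    interval_cases a <;> interval_cases b <;> first
      | omega
      | exact eq_zero_of_below_not_below_aux (h := 2) (by decide) (by decide) b2 hk hk'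
      | exact eq_zero_of_below_not_below_aux (h := 3) (by decide) (by decide)
          (b2.succ (by decide) (by decide)) hk hk'
      | exact eq_zero_of_below_not_below_aux (h := 5) (by decide) (by decide)
          (((b2.succ (by decide) (by decide)).succ (by decide) (by decide)).succ
            (by decide) (by decide)) hk hk'

lemma RankTwoData.cheb_succ_nonneg (h : RankTwoData a b) {k : ℕ} (hk : Below a b k) :
    0 ≤ cheb a b (k + 1) ∧ 0 ≤ chebDual a b (k + 1) := by
  by_cases hk' : Below a b (k + 1)
  · exact ⟨hk'.cheb_nonneg, hk'.chebDual_nonneg⟩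
  · have := h.eq_zero_of_not_below hk hk'
    omega

/-- Just below the Coxeter number both sequences are `1`. -/
lemma RankTwoData.eq_one_of_not_below (h : RankTwoData a b) {k : ℕ} (hk : Below a b (k + 1))
    (hk' : ¬Below a b (k + 2)) : cheb a b (k + 1) = 1 ∧ chebDual a b (k + 1) = 1 := by
  have h0 := h.eq_zero_of_not_below hk hk'
  have hd := cheb_det (a := a) (b := b) k
  rw [h0.2, zero_mul, sub_zero] at hd
  have := hk (k + 1) (by omega) le_rfl
  rcases Int.mul_eq_one_iff_eq_one_or_neg_one.mp hd with h | h
  · exact h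
  · omega

end RankTwo

section RankTwo

/-- `β_k(x) = x_k - a_k x_{k+1} + x_{k+2}`, the difference `σ_k(x) - σ_{k+2}(x)`. -/
def sigDiff (a b : ℤ) (x : ℕ →₀ ℤ) (k : ℕ) : ℤ := x k - coefAt a b k * x (k + 1) + x (k + 2)

/-- The polyhedral description of `B(∞)` in rank two. -/
structure Fam (a b : ℤ) (x : ℕ →₀ ℤ) : Prop where
  zero : x 0 = 0
  nonneg : ∀ k, 0 ≤ x k
  below : ∀ k, 1 ≤ k → x (k + 1) ≠ 0 → Below a b k
  ineq : ∀ k, Below a b (k + 1) → cheb a b k * x (k + 2) ≤ cheb a b (k + 1) * x (k + 1)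

variable {a b : ℤ} {x : ℕ →₀ ℤ}

/-- `σ_k` in rank two. -/
abbrev sigT (a b : ℤ) (x : ℕ →₀ ℤ) (k : ℕ) : ℤ := sig (cartanTwo a b) alt k x

/-- `f̃_c` acts at position `k` in rank two. -/
abbrev ActsT (a b : ℤ) (c : Bool) (x : ℕ →₀ ℤ) (k : ℕ) : Prop :=
  ActsAt (cartanTwo a b) alt 1 c x k

/-- `ε_c` in rank two. -/
abbrev epsT (a b : ℤ) (c : Bool) (x : ℕ →₀ ℤ) : ℤ := tailMax (cartanTwo a b) alt 1 c x

lemma sigT_eq (x : ℕ →₀ ℤ) (k : ℕ) : sigT a b x k = sigDiff a b x k + sigT a b x (k + 2) := by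
  unfold sigT sigDiff
  rw [sig_eq, sig_eq, tailSum_succ, tailSum_succ, cartanTwo_alt, alt_add_two, add_assoc k 1 1,
    cartanTwo_self]
  ring

lemma ActsT.sigDiff_nonneg {c : Bool} {k : ℕ} (h : ActsT a b c x k) : 0 ≤ sigDiff a b x k := by
  have h1 := h.max (k + 2) (by have := h.le; omega) (by rw [alt_add_two]; exact h.color)
  have := sigT_eq (a := a) (b := b) x k
  simp only [sigT] at this
  omega

lemma ActsT.sigDiff_neg {c : Bool} {k : ℕ} (h : ActsT a b c x (k + 2)) (hk : 1 ≤ k) :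
    sigDiff a b x k < 0 := by
  have h1 := h.first k hk (by omega) (by rw [← alt_add_two]; exact h.color)
  have := sigT_eq (a := a) (b := b) x k
  simp only [sigT] at this
  omega

lemma Fam.zero_mem : Fam a b 0 := ⟨by simp, by simp, by simp, by simp⟩

lemma Fam.eq_zero (h : Fam a b x) {k : ℕ} (hk : ¬Below a b (k + 1)) {j : ℕ} (hj : k + 2 ≤ j) :
    x j = 0 := by
  by_contra hne
  obtain ⟨j, rfl⟩ : ∃ i, j = i + 1 := ⟨j - 1, by omega⟩
  exact hk ((h.below j (by omega) hne).mono (by omega))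

lemma Fam.succ (hab : RankTwoData a b) (h : Fam a b x) {c : Bool} {k : ℕ} (hf : ActsT a b c x k) :
    Fam a b (x + Finsupp.single k 1) := by
  have hk1 := hf.le
  refine ⟨?_, fun j => ?_, fun j hj hne => ?_, fun j hj => ?_⟩
  · rw [Finsupp.add_apply, Finsupp.single_apply, if_neg (by omega), h.zero, add_zero]
  · rw [Finsupp.add_apply, Finsupp.single_apply]
    have := h.nonneg j
    split_ifs <;> omega
  · by_contra hb
    have hx : x (j + 1) = 0 := by_contra fun h' => hb (h.below j hj h')
    obtain rfl : k = j + 1 := by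
      by_contra hkj
      rw [Finsupp.add_apply, Finsupp.single_apply, if_neg hkj, hx] at hne
      exact hne rfl
    obtain ⟨i, rfl⟩ : ∃ i, j = i + 1 := ⟨j - 1, by omega⟩
    rcases i with _ | i
    · exact hb below_one
    have hd := hf.sigDiff_neg (k := i + 1) (by omega)
    unfold sigDiff at hd
    rw [hx] at hd
    have h1 := h.nonneg (i + 1)
    have h2 := h.nonneg (i + 2)
    have hne : x (i + 2) ≠ 0 := fun h0 => by
      rw [h0] at hd; omega
    have hB := h.below (i + 1) (by omega) hne
    have h0 := hab.eq_zero_of_not_below hB hb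
    have h1' := hab.eq_one_of_not_below hB hb
    have hi := h.ineq i hB
    rw [cheb_succ_succ, h1'.1] at h0
    rw [h1'.1] at hi
    have h3 : cheb a b i = coefAt a b (i + 1) := by linarith [h0.1]
    rw [h3] at hi
    linarith
  · have hx := h.ineq j hj
    have hc := hj.cheb_nonneg
    have hc' := (hj.mono (Nat.le_succ j)).cheb_nonneg
    rw [Finsupp.add_apply, Finsupp.add_apply, Finsupp.single_apply, Finsupp.single_apply]
    split_ifs with e1 e2 e2
    · omega
    · rcases j with _ | j
      · have := mul_nonneg hc (h.nonneg 1)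
        simpa using this
      subst e1
      have hd := hf.sigDiff_neg (k := j + 1) (by omega)
      unfold sigDiff at hd
      have hi := h.ineq j (hj.mono (by omega))
      have e := cheb_succ_succ (a := a) (b := b) j
      have h5 : cheb a b (j + 1) * (x (j + 1 + 2) + 1) ≤
          cheb a b (j + 1) * (coefAt a b (j + 1) * x (j + 2) - x (j + 1)) :=
        mul_le_mul_of_nonneg_left (by linarith) hc'
      have h6 : cheb a b (j + 1 + 1) * (x (j + 1 + 1) + 0) = 
        coefAt a b (j + 1) * cheb a b (j + 1) * x (j + 2) - cheb a b j * x (j + 2) := by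
        rw [e]; ring
      rw [h6]
      linarith
    · nlinarith
    · simpa using hx

/-- Descent: if `ε_c(x) > 0` then `x` is in the image of `f̃_c`. -/
lemma exists_actsAt_sub {S : Type*} {A : S → S → ℤ} {ι : ℕ → S} (hA : ∀ i, A i i = 2)
    (hι : ∀ i : S, {k : ℕ | 1 ≤ k ∧ ι k = i}.Infinite) {K : ℕ} {i : S}
    {x : ℕ →₀ ℤ} (h : 0 < tailMax A ι K i x) : ∃ k, K ≤ k ∧ ι k = i ∧
      sig A ι k x = tailMax A ι K i x ∧ (∀ j, k < j → ι j = i → sig A ι j x < sig A ι k x) ∧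
      ActsAt A ι K i (x - Finsupp.single k 1) k := by
  classical
  obtain ⟨N, hN⟩ := exists_bound x
  obtain ⟨k₀, hk₀⟩ := exists_actsAt (A := A) hι K i x
  have hle : ∀ k, K ≤ k → ι k = i → sig A ι k x = tailMax A ι K i x → k ≤ N := by
    intro k _ _ hs
    by_contra hlt
    rw [sig_of_large hN (by omega)] at hs
    omega
  let p : ℕ → Prop := fun k => K ≤ k ∧ ι k = i ∧ sig A ι k x = tailMax A ι K i x
  have hp₀ : p k₀ := ⟨hk₀.le, hk₀.color, hk₀.tailMax_eq.symm⟩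
  obtain ⟨h1, h2, h3⟩ : p (Nat.findGreatest p N) :=
    Nat.findGreatest_spec (hle k₀ hp₀.1 hp₀.2.1 hp₀.2.2) hp₀
  set k := Nat.findGreatest p N
  have hgt : ∀ j, k < j → ι j = i → sig A ι j x < sig A ι k x := by
    intro j hj hji
    refine lt_of_le_of_ne (by rw [h3]; exact sig_le_tailMax hι x (by omega) hji) fun he => ?_
    rw [h3] at he
    have := Nat.le_findGreatest (P := p) (hle j (by omega) hji he) ⟨by omega, hji, he⟩
    omega
  refine ⟨k, h1, h2, h3, hgt, h1, h2, fun j hj hji => ?_, fun j hj hlt hji => ?_⟩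
  · have hj' := sig_le_tailMax (A := A) hι x hj hji
    rw [sub_eq_add_neg, ← Finsupp.single_neg, sig_add, sig_add, sig_single, sig_single,
      if_pos rfl]
    rcases lt_trichotomy j k with hl | hl | hl
    · rw [if_neg (by omega), if_pos hl, hji, h2, hA]; omega
    · rw [hl]; simp
    · rw [if_neg (by omega), if_neg (by omega)]
      have := hgt j hl hji
      omega
  · have hj' := sig_le_tailMax (A := A) hι x hj hji
    rw [sub_eq_add_neg, ← Finsupp.single_neg, sig_add, sig_add, sig_single, sig_single,
      if_pos rfl, if_neg (by omega), if_pos hlt, hji, h2, hA]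
    omega

lemma Fam.exists_pred (hab : RankTwoData a b) (h : Fam a b x) {c : Bool}
    (hc : 0 < epsT a b c x) : ∃ y k, Fam a b y ∧ ActsT a b c y k ∧ x = y + Finsupp.single k 1 := by
  obtain ⟨k, hk1, hkc, hs, hgt, hf⟩ := exists_actsAt_sub (cartanTwo_self (a := a) (b := b))
    alt_infinite hc
  refine ⟨x - Finsupp.single k 1, k, ?_, hf, by simp⟩
  have hd : 1 ≤ sigDiff a b x k := by
    have h1 := hgt (k + 2) (by omega) (by rw [alt_add_two, hkc])
    have h2 := sigT_eq (a := a) (b := b) x k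
    simp only [sigT] at h2
    omega
  unfold sigDiff at hd
  obtain ⟨k, rfl⟩ : ∃ i, k = i + 1 := ⟨k - 1, by omega⟩
  have key : Below a b (k + 1) →
      cheb a b k * x (k + 2) ≤ cheb a b (k + 1) * (x (k + 1) - 1) := by
    intro hB
    have hc := hB.cheb_nonneg
    have h1 : cheb a b (k + 1) * (coefAt a b (k + 1) * x (k + 2) - x (k + 3)) ≤
        cheb a b (k + 1) * (x (k + 1) - 1) := mul_le_mul_of_nonneg_left (by linarith) hc
    have e := cheb_succ_succ (a := a) (b := b) k
    have h2 : cheb a b (k + 1) * x (k + 3) ≤ cheb a b (k + 2) * x (k + 2) := by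
      by_cases hB' : Below a b (k + 2)
      · exact h.ineq (k + 1) hB'
      · rw [(hab.eq_zero_of_not_below hB hB').1, h.eq_zero hB' (j := k + 3) (by omega)]
        simp
    rw [e] at h2
    linarith
  have hpos : 0 ≤ x (k + 1) - 1 := by
    by_cases hB : Below a b (k + 1)
    · have h1 := key hB
      have h2 := (hB (k + 1) (by omega) le_rfl).1
      have h3 := mul_nonneg (hB.mono (Nat.le_succ k)).cheb_nonneg (h.nonneg (k + 2))
      exact nonneg_of_mul_nonneg_right (h3.trans h1) h2
    · rw [h.eq_zero hB (j := k + 1 + 1) (by omega), h.eq_zero hB (j := k + 1 + 2) (by omega)] at hd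
      linarith
  refine ⟨?_, fun j => ?_, fun j hj hne => ?_, fun j hj => ?_⟩
  · simp [h.zero]
  · rw [Finsupp.sub_apply, Finsupp.single_apply]
    split_ifs with e
    · rw [← e]; exact hpos
    · simpa using h.nonneg j
  · refine h.below j hj fun h0 => hne ?_
    rw [Finsupp.sub_apply, Finsupp.single_apply, h0]
    split_ifs with e
    · rw [← e] at h0; omega
    · simp
  · rw [Finsupp.sub_apply, Finsupp.sub_apply, Finsupp.single_apply, Finsupp.single_apply]
    split_ifs with e1 e2 e2
    · omega
    · have := h.ineq j hj
      have h2 := (hj.mono (Nat.le_succ j)).cheb_nonneg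
      rw [sub_zero]
      nlinarith
    · obtain rfl : j = k := by omega
      simpa using key hj
    · simpa using h.ineq j hj

lemma Fam.exists_eps_pos (h : Fam a b x) (hx : x ≠ 0) : ∃ c, 0 < epsT a b c x := by
  have hne : x.support.Nonempty := Finsupp.support_nonempty_iff.mpr hx
  set k := x.support.max' hne
  have hk : x k ≠ 0 := Finsupp.mem_support_iff.mp (x.support.max'_mem hne)
  have hgt : ∀ j, k < j → x j = 0 := fun j hj => by
    by_contra h'
    have := x.support.le_max' j (Finsupp.mem_support_iff.mpr h')
    omega
  have hk1 : 1 ≤ k := by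
    by_contra h'
    exact hk (by rw [show k = 0 by omega]; exact h.zero)
  refine ⟨alt k, lt_of_lt_of_le ?_ (sig_le_tailMax alt_infinite x hk1 rfl)⟩
  rw [sig_eq, tailSum_eq_zero _ _ fun j hj => hgt j (by omega), add_zero]
  exact lt_of_le_of_ne (h.nonneg k) hk.symm

/-- The sum of the coordinates. -/
def height (x : ℕ →₀ ℤ) : ℤ := x.sum fun _ v => v

lemma height_add_single (x : ℕ →₀ ℤ) (k : ℕ) :
    height (x + Finsupp.single k 1) = height x + 1 := by
  unfold height
  rw [Finsupp.sum_add_index' (fun _ => rfl) fun _ _ _ => rfl, Finsupp.sum_single_index rfl]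

lemma height_nonneg (h : ∀ k, 0 ≤ x k) : 0 ≤ height x := Finset.sum_nonneg fun k _ => h k

/-- `Fam` is generated from `0` by the operators `f̃_c`. -/
lemma Fam.induction (hab : RankTwoData a b) {P : (ℕ →₀ ℤ) → Prop} (h0 : P 0)
    (hs : ∀ x c k, Fam a b x → ActsT a b c x k → P x → P (x + Finsupp.single k 1))
    {x : ℕ →₀ ℤ} (hx : Fam a b x) : P x := by
  induction hn : (height x).toNat using Nat.strong_induction_on generalizing x with
  | _ n ih =>
    by_cases hx0 : x = 0
    · rw [hx0]; exact h0
    obtain ⟨c, hc⟩ := hx.exists_eps_pos hx0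
    obtain ⟨y, k, hy, hf, rfl⟩ := hx.exists_pred hab hc
    have h1 := height_add_single y k
    have h2 := height_nonneg hy.nonneg
    exact hs y c k hy hf (ih _ (by omega) hy rfl)

end RankTwo

section RankTwo

variable {a b : ℤ} {x x' : ℕ →₀ ℤ}

/-- The linear forms whose maximum is the starred `ε` of the second colour. -/
def starForm (a b : ℤ) (x : ℕ →₀ ℤ) (k : ℕ) : ℤ :=
  chebDual a b k * x (k + 1) - chebDual a b (k + 1) * x k

/-- The starred `ε` of the second colour. -/
def starMax (a b : ℤ) (x : ℕ →₀ ℤ) : ℤ := sSup (Set.range (starForm a b x))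

lemma starForm_succ (x : ℕ →₀ ℤ) (k : ℕ) :
    starForm a b x (k + 1) = starForm a b x k + chebDual a b (k + 1) * sigDiff a b x k := by
  unfold starForm sigDiff
  rw [chebDual_succ_succ]; ring

lemma starForm_add_single (x : ℕ →₀ ℤ) (k j : ℕ) :
    starForm a b (x + Finsupp.single k 1) j = starForm a b x j +
      (if k = j + 1 then chebDual a b j else 0) - (if k = j then chebDual a b (j + 1) else 0) := by
  unfold starForm
  simp only [Finsupp.add_apply, Finsupp.single_apply]
  split_ifs <;> ring

lemma sigDiff_add_single (x : ℕ →₀ ℤ) (k j : ℕ) :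
    sigDiff a b (x + Finsupp.single k 1) j = sigDiff a b x j + (if k = j then 1 else 0) -
      (if k = j + 1 then coefAt a b j else 0) + (if k = j + 2 then 1 else 0) := by
  unfold sigDiff
  simp only [Finsupp.add_apply, Finsupp.single_apply]
  split_ifs <;> ring

lemma Fam.starForm_zero (h : Fam a b x) : starForm a b x 0 = 0 := by
  simp [starForm, h.zero]

lemma starMax_eq_of {p : ℤ} (h₁ : ∀ k, starForm a b x k ≤ p) (h₂ : ∃ k, starForm a b x k = p) :
    starMax a b x = p :=
  IsGreatest.csSup_eq ⟨h₂, by rintro _ ⟨k, rfl⟩; exact h₁ k⟩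

lemma exists_starForm_isMax (x : ℕ →₀ ℤ) : ∃ k, ∀ j, starForm a b x j ≤ starForm a b x k := by
  obtain ⟨N, hN⟩ := exists_bound x
  obtain ⟨k, -, hk⟩ := Finset.exists_max_image (Finset.range (N + 1)) (starForm a b x) ⟨0, by simp⟩
  refine ⟨k, fun j => ?_⟩
  rcases le_or_gt j N with h | h
  · exact hk j (by simp; omega)
  · have h0 : ∀ i, N ≤ i → starForm a b x i = 0 := fun i hi => by
      simp [starForm, hN i hi, hN (i + 1) (by omega)]
    rw [h0 j h.le, ← h0 N le_rfl]
    exact hk N (by simp)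

lemma exists_starForm_eq (x : ℕ →₀ ℤ) : ∃ k, starForm a b x k = starMax a b x := by
  obtain ⟨k, hk⟩ := exists_starForm_isMax (a := a) (b := b) x
  exact ⟨k, (starMax_eq_of hk ⟨k, rfl⟩).symm⟩

lemma starForm_le (x : ℕ →₀ ℤ) (j : ℕ) : starForm a b x j ≤ starMax a b x := by
  obtain ⟨k, hk⟩ := exists_starForm_isMax (a := a) (b := b) x
  rw [starMax_eq_of hk ⟨k, rfl⟩]
  exact hk j

lemma Fam.starForm_eq_of_not_below (hab : RankTwoData a b) (h : Fam a b x) {k : ℕ}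
    (hk : Below a b k) (hk' : ¬Below a b (k + 1)) :
    starForm a b x (k + 1) = starForm a b x k := by
  rcases k with _ | k
  · exact absurd below_one hk'
  have h0 := hab.eq_zero_of_not_below hk hk'
  have h1 := hab.eq_one_of_not_below hk hk'
  rw [starForm, starForm, chebDual_succ_succ (k + 1), h0.2, h1.2, h.eq_zero hk' le_rfl]
  ring

/-- The position acted on is at most the Coxeter number. -/
lemma Fam.below_of_acts (hab : RankTwoData a b) (h : Fam a b x) {c : Bool} {k : ℕ}
    (hf : ActsT a b c x (k + 1)) : Below a b k := by
  rcases k with _ | k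
  · exact below_zero
  refine (h.succ hab hf).below (k + 1) (by omega) ?_
  have := h.nonneg (k + 1 + 1)
  simp; omega

/-- If the action is not at position `2` with `form_1` maximal, then the form preceding the
position acted on is not maximal, even after the action. -/
lemma Fam.starForm_add_le (hab : RankTwoData a b) (h : Fam a b x) {c : Bool} {k : ℕ}
    (hf : ActsT a b c x (k + 1)) (hnd : k = 1 → starForm a b x 1 ≠ starMax a b x) :
    starForm a b x k + chebDual a b k ≤ starMax a b x := by
  rcases k with _ | _ | k
  · simpa using starForm_le x 0
  · have := starForm_le (a := a) (b := b) x 1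
    have := hnd rfl
    simp only [zero_add, chebDual_one]
    omega
  · have hd := hf.sigDiff_neg (k := k + 1) (by omega)
    have hB := (h.below_of_acts hab hf).chebDual_nonneg
    rw [starForm_succ]
    have := starForm_le (a := a) (b := b) x (k + 1)
    nlinarith

lemma Fam.starMax_succ (hab : RankTwoData a b) (h : Fam a b x) {c : Bool} {k : ℕ}
    (hf : ActsT a b c x (k + 1)) (hnd : k = 1 → starForm a b x 1 ≠ starMax a b x) :
    starMax a b (x + Finsupp.single (k + 1) 1) = starMax a b x := by
  have hy := h.succ hab hf
  have hB := h.below_of_acts hab hf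
  have hle := h.starForm_add_le hab hf hnd
  have hk : starForm a b (x + Finsupp.single (k + 1) 1) k = starForm a b x k + chebDual a b k := by
    rw [starForm_add_single]; simp
  have hk1 : starForm a b (x + Finsupp.single (k + 1) 1) (k + 1) =
      starForm a b x (k + 1) - chebDual a b (k + 2) := by
    rw [starForm_add_single]; simp
  have hoth : ∀ j, j ≠ k → j ≠ k + 1 →
      starForm a b (x + Finsupp.single (k + 1) 1) j = starForm a b x j := fun j h1 h2 => by
    rw [starForm_add_single, if_neg (by omega), if_neg (by omega)]; ring
  refine starMax_eq_of (fun j => ?_) ?_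
  · by_cases e1 : j = k
    · subst e1; omega
    by_cases e2 : j = k + 1
    · subst e2
      by_cases hB' : Below a b (k + 1)
      · have h1 : 0 ≤ chebDual a b (k + 2) := (hab.cheb_succ_nonneg hB').2
        have h2 := starForm_le (a := a) (b := b) x (k + 1)
        omega
      · rw [hy.starForm_eq_of_not_below hab hB hB']; omega
    · rw [hoth j e1 e2]; exact starForm_le x j
  · obtain ⟨j, hj⟩ := exists_starForm_eq (a := a) (b := b) x
    have hd := hB.chebDual_nonneg
    by_cases e1 : j = k
    · subst e1; exact ⟨j, by omega⟩
    by_cases e2 : j = k + 1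
    · subst e2
      by_cases hB' : Below a b (k + 1)
      · refine ⟨k + 1 + 1, ?_⟩
        rw [hoth _ (by omega) (by omega)]
        have h1 := (hab.cheb_succ_nonneg hB').2
        have h2 := mul_nonneg h1 hf.sigDiff_nonneg
        have h3 := starForm_succ (a := a) (b := b) x (k + 1)
        have h4 := starForm_le (a := a) (b := b) x (k + 1 + 1)
        omega
      · have := h.starForm_eq_of_not_below hab hB hB'
        exact ⟨k, by omega⟩
    · exact ⟨j, by rw [hoth j e1 e2, hj]⟩

/-- The starred `ẽ` of the second colour sends `x` to `x'`; the correction of `x` is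
`x'_k - x_k = δ_{k+1} - δ_{k-1}`. -/
structure StarStep (a b : ℤ) (x x' : ℕ →₀ ℤ) (k₀ : ℕ) (δ : ℕ → ℤ) : Prop where
  one_le : 1 ≤ k₀
  pos : 0 < starMax a b x
  attained : starForm a b x k₀ = starMax a b x
  last : ∀ k, k₀ < k → starForm a b x k < starMax a b x
  low : ∀ k, k ≤ k₀ → δ k = cheb a b k
  high : ∀ k, k₀ ≤ k + 1 → δ (k + 2) = if δ (k + 1) = 0 then 0 else
    max 0 (coefAt a b (k + 1) * δ (k + 1) - δ k + sigDiff a b x (k + 1))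
  bounded : ∃ N, ∀ k, N ≤ k → δ k = 0
  val_zero : x' 0 = 0
  val : ∀ k, x' (k + 1) = x (k + 1) + δ (k + 2) - δ k

namespace StarStep

variable {k₀ : ℕ} {δ : ℕ → ℤ}

lemma unique {y y' : ℕ →₀ ℤ} {k₁ : ℕ} {δ' : ℕ → ℤ} (h : StarStep a b x y k₀ δ)
    (h' : StarStep a b x y' k₁ δ') : y = y' := by
  have e : k₀ = k₁ := by
    rcases lt_trichotomy k₀ k₁ with hl | hl | hl
    · exact absurd h'.attained (h.last k₁ hl).ne
    · exact hl
    · exact absurd h.attained (h'.last k₀ hl).ne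
  subst e
  have hδ : ∀ k, δ k = δ' k ∧ δ (k + 1) = δ' (k + 1) := by
    intro k
    induction k with
    | zero =>
      refine ⟨by rw [h.low 0 (by omega), h'.low 0 (by omega)], ?_⟩
      rw [h.low 1 h.one_le, h'.low 1 h.one_le]
    | succ k ih =>
      refine ⟨ih.2, ?_⟩
      rcases le_or_gt k₀ (k + 1) with hk | hk
      · rw [h.high k hk, h'.high k hk, ih.1, ih.2]
      · rw [h.low _ hk, h'.low _ hk]
  ext k
  rcases k with _ | k
  · rw [h.val_zero, h'.val_zero]
  · rw [h.val, h'.val, (hδ k).1, (hδ (k + 1)).2]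

end StarStep

end RankTwo

section RankTwo

variable {a b : ℤ} {x x' : ℕ →₀ ℤ}

namespace StarStep

variable {k₀ : ℕ} {δ : ℕ → ℤ}

lemma below (hx : Fam a b x) (h : StarStep a b x x' (k₀ + 1) δ) : Below a b k₀ := by
  have h1 := h.pos
  rw [← h.attained] at h1
  rcases k₀ with _ | k
  · exact below_zero
  by_contra hB
  rw [starForm, hx.eq_zero hB (j := k + 1 + 1) (by omega),
    hx.eq_zero hB (j := k + 1 + 1 + 1) (by omega)] at h1
  simp at h1

lemma nonneg (hx : Fam a b x) (hab : RankTwoData a b) (h : StarStep a b x x' k₀ δ) (k : ℕ) :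
    0 ≤ δ k := by
  rcases le_or_gt k k₀ with hk | hk
  · rw [h.low k hk]
    obtain ⟨i, rfl⟩ : ∃ i, k₀ = i + 1 := ⟨k₀ - 1, by have := h.one_le; omega⟩
    have hB := h.below hx
    rcases Nat.lt_or_ge i k with h' | h'
    · obtain rfl : k = i + 1 := by omega
      exact (hab.cheb_succ_nonneg hB).1
    · exact (hB.mono h').cheb_nonneg
  · obtain ⟨i, rfl⟩ : ∃ i, k = i + 2 := ⟨k - 2, by have := h.one_le; omega⟩
    rw [h.high i (by omega)]
    split_ifs
    · exact le_rfl
    · exact le_max_left _ _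

lemma sig_eq (h : StarStep a b x x' k₀ δ) (k : ℕ) : sigT a b x' (k + 1) =
    sigT a b x (k + 1) + (coefAt a b (k + 1) * δ (k + 1) - δ k - δ (k + 2)) := by
  obtain ⟨N, hN⟩ := h.bounded
  obtain ⟨N₁, hN₁⟩ := exists_bound x
  obtain ⟨N₂, hN₂⟩ := exists_bound x'
  suffices H : ∀ d k, N + N₁ + N₂ ≤ k + d → sigT a b x' (k + 1) =
      sigT a b x (k + 1) + (coefAt a b (k + 1) * δ (k + 1) - δ k - δ (k + 2)) from
    H (N + N₁ + N₂) k (by omega)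
  intro d
  induction d with
  | zero =>
    intro k hk
    rw [sigT, sig_of_large hN₂ (by omega), sigT, sig_of_large hN₁ (by omega), hN _ (by omega),
      hN _ (by omega), hN _ (by omega)]
    ring
  | succ d ih =>
    intro k hk
    have := ih (k + 2) (by omega)
    rw [sigT_eq x', sigT_eq x, show k + 1 + 2 = k + 2 + 1 by ring, this]
    unfold sigDiff
    rw [show k + 1 + 1 = k + 2 by ring, show k + 1 + 2 = k + 2 + 1 by ring,
      show k + 2 = (k + 1) + 1 by ring, h.val, h.val, show k + 1 + 1 + 1 = (k + 2) + 1 by ring,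
      h.val, show k + 2 + 1 = k + 1 + 2 by ring, coefAt_add_two]
    ring

lemma sig_eq' (h : StarStep a b x x' k₀ δ) (k : ℕ) : sigT a b x' (k + 1) =
    sigT a b x (k + 3) +
      (coefAt a b (k + 1) * δ (k + 1) - δ k + sigDiff a b x (k + 1) - δ (k + 2)) := by
  rw [h.sig_eq, sigT_eq x]; ring

lemma sig_eq_of_lt (h : StarStep a b x x' k₀ δ) {k : ℕ} (hk : k + 2 ≤ k₀) :
    sigT a b x' (k + 1) = sigT a b x (k + 1) := by
  rw [h.sig_eq, h.low _ hk, h.low _ (by omega : k + 1 ≤ k₀), h.low _ (by omega : k ≤ k₀),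
    cheb_succ_succ]
  ring

/-- `σ_j(x') ≤ max(σ_j(x), σ_{j+2}(x))`. -/
lemma sig_le (hab : RankTwoData a b) (hx : Fam a b x) (h : StarStep a b x x' k₀ δ) (k : ℕ) :
    sigT a b x' (k + 1) ≤ sigT a b x (k + 1) ∨ sigT a b x' (k + 1) ≤ sigT a b x (k + 3) := by
  rcases Nat.lt_or_ge (k + 1) k₀ with hk | hk
  · exact .inl (h.sig_eq_of_lt hk).le
  have hh := h.high k hk
  split_ifs at hh with h0
  · left
    rw [h.sig_eq, hh, h0]
    have := h.nonneg hx hab k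
    linarith
  · right
    rw [h.sig_eq', hh]
    have := le_max_right 0 (coefAt a b (k + 1) * δ (k + 1) - δ k + sigDiff a b x (k + 1))
    linarith

lemma tailMax_le (hab : RankTwoData a b) (hx : Fam a b x) (h : StarStep a b x x' k₀ δ) (c : Bool) :
    epsT a b c x' ≤ epsT a b c x := by
  obtain ⟨k, hk⟩ := exists_actsAt (A := cartanTwo a b) alt_infinite 1 c x'
  rw [epsT, hk.tailMax_eq]
  obtain ⟨k, rfl⟩ : ∃ i, k = i + 1 := ⟨k - 1, by have := hk.le; omega⟩
  have hc := hk.color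
  rcases h.sig_le hab hx k with h1 | h1
  · exact h1.trans (sig_le_tailMax alt_infinite x (by omega) hc)
  · exact h1.trans (sig_le_tailMax alt_infinite x (by omega) (by rw [alt_add_two (k + 1), hc]))

end StarStep

end RankTwo

section RankTwo

variable {a b : ℤ} {x x' : ℕ →₀ ℤ}

namespace StarStep

variable {k₀ : ℕ} {δ : ℕ → ℤ} {c : Bool} {k : ℕ}

lemma starForm_lt (hab : RankTwoData a b) (hx : Fam a b x) (h : StarStep a b x x' k₀ δ)
    (hf : ActsT a b c x (k + 1)) (hnd : k = 1 → starForm a b x 1 ≠ starMax a b x) :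
    starForm a b x k < starMax a b x := by
  rcases k with _ | k
  · rw [hx.starForm_zero]; exact h.pos
  · have h1 := hx.starForm_add_le hab hf hnd
    have := (hx.below_of_acts hab hf (k + 1) (by omega) le_rfl).2
    omega

lemma pos_ne (hab : RankTwoData a b) (hx : Fam a b x) (h : StarStep a b x x' k₀ δ)
    (hf : ActsT a b c x (k + 1)) (hnd : k = 1 → starForm a b x 1 ≠ starMax a b x) :
    k ≠ k₀ ∧ k + 1 ≠ k₀ := by
  have hlt := h.starForm_lt hab hx hf hnd
  refine ⟨?_, ?_⟩
  · rintro rfl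
    exact hlt.ne h.attained
  · rintro rfl
    by_cases hB : Below a b (k + 1)
    · have h1 := (hab.cheb_succ_nonneg hB).2
      have h2 := mul_nonneg h1 hf.sigDiff_nonneg
      have h3 := starForm_succ (a := a) (b := b) x (k + 1)
      have h4 := h.last (k + 1 + 1) (by omega)
      have h5 := h.attained
      omega
    · have := hx.starForm_eq_of_not_below hab (hx.below_of_acts hab hf) hB
      exact hlt.ne (this.symm.trans h.attained)

lemma acts_of (hab : RankTwoData a b) (hx : Fam a b x) (h : StarStep a b x x' k₀ δ)
    (hf : ActsT a b c x k) {k' : ℕ} (hk' : 1 ≤ k') (hc : alt k' = c)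
    (hs : sigT a b x' k' = sigT a b x k)
    (hlt : ∀ j, j + 1 < k' → alt (j + 1) = c → sigT a b x' (j + 1) < sigT a b x k) :
    ActsT a b c x' k' := by
  refine ⟨hk', hc, fun j hj hjc => ?_, fun j hj hjk hjc => ?_⟩
  · change sigT a b x' j ≤ sigT a b x' k'
    rw [hs]
    obtain ⟨j, rfl⟩ : ∃ i, j = i + 1 := ⟨j - 1, by omega⟩
    rcases h.sig_le hab hx j with h1 | h1
    · exact h1.trans (hf.max _ hj hjc)
    · exact h1.trans (hf.max _ (by omega) (by rw [alt_add_two (j + 1), hjc]))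
  · change sigT a b x' j < sigT a b x' k'
    rw [hs]
    obtain ⟨j, rfl⟩ : ∃ i, j = i + 1 := ⟨j - 1, by omega⟩
    exact hlt j hjk hjc

lemma sig_lt (hab : RankTwoData a b) (hx : Fam a b x) (h : StarStep a b x x' k₀ δ)
    (hf : ActsT a b c x k) {j : ℕ} (hj : j + 3 < k) (hjc : alt (j + 1) = c) :
    sigT a b x' (j + 1) < sigT a b x k := by
  rcases h.sig_le hab hx j with h1 | h1
  · exact h1.trans_lt (hf.first _ (by omega) (by omega) hjc)
  · exact h1.trans_lt (hf.first _ (by omega) (by omega) (by rw [alt_add_two (j + 1), hjc]))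

lemma step_of_lt (hab : RankTwoData a b) (hx : Fam a b x) (h : StarStep a b x x' k₀ δ)
    (hf : ActsT a b c x (k + 1)) (hnd : k = 1 → starForm a b x 1 ≠ starMax a b x)
    (hk : k + 1 < k₀) : ActsT a b c x' (k + 1) ∧ sigT a b x' (k + 1) = sigT a b x (k + 1) ∧
      StarStep a b (x + Finsupp.single (k + 1) 1) (x' + Finsupp.single (k + 1) 1) k₀ δ := by
  have hs := h.sig_eq_of_lt hk
  have hp := hx.starMax_succ hab hf hnd
  refine ⟨h.acts_of hab hx hf (by omega) hf.color hs fun j hj hjc => ?_, hs, h.one_le, ?_, ?_,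
    fun j hj => ?_, h.low, fun j hj => ?_, h.bounded, ?_, fun j => ?_⟩
  · rw [h.sig_eq_of_lt (by omega)]
    exact hf.first _ (by omega) hj hjc
  · rw [hp]; exact h.pos
  · rw [hp, starForm_add_single, if_neg (by omega), if_neg (by omega), h.attained]; ring
  · rw [hp, starForm_add_single, if_neg (by omega), if_neg (by omega)]
    have := h.last j hj
    omega
  · have e : sigDiff a b (x + Finsupp.single (k + 1) 1) (j + 1) = sigDiff a b x (j + 1) := by
      rw [sigDiff_add_single, if_neg (by omega), if_neg (by omega), if_neg (by omega)]; ring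
    rw [e]; exact h.high j hj
  · simp [h.val_zero]
  · simp only [Finsupp.add_apply, h.val]; ring

lemma eq_zero_of_le (h : StarStep a b x x' k₀ δ) {n : ℕ} (hn : k₀ ≤ n) (h0 : δ n = 0) {j : ℕ}
    (hj : n ≤ j) : δ j = 0 := by
  induction j, hj using Nat.le_induction with
  | base => exact h0
  | succ j hj ih =>
    obtain ⟨i, rfl⟩ : ∃ i, j = i + 1 := ⟨j - 1, by have := h.one_le; omega⟩
    rw [h.high i (by omega), if_pos ih]

lemma last_of_add (hab : RankTwoData a b) (hx : Fam a b x) (h : StarStep a b x x' k₀ δ)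
    (hf : ActsT a b c x (k + 1)) (hk : k₀ ≤ k)
    (hlt : starForm a b x k + chebDual a b k < starMax a b x) {j : ℕ} (hj : k₀ < j) :
    starForm a b (x + Finsupp.single (k + 1) 1) j < starMax a b x := by
  have hB := hx.below_of_acts hab hf
  by_cases e1 : j = k
  · subst e1
    rw [starForm_add_single, if_pos rfl, if_neg (by omega)]; omega
  by_cases e2 : j = k + 1
  · subst e2
    by_cases hB' : Below a b (k + 1)
    · have h1 : 0 ≤ chebDual a b (k + 1 + 1) := (hab.cheb_succ_nonneg hB').2
      have h2 := h.last (k + 1) hj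
      rw [starForm_add_single, if_neg (by omega), if_pos rfl]; omega
    · rw [(hx.succ hab hf).starForm_eq_of_not_below hab hB hB', starForm_add_single, if_pos rfl,
        if_neg (by omega)]
      omega
  · rw [starForm_add_single, if_neg (by omega), if_neg (by omega)]
    have := h.last j hj
    omega

lemma step_of_sum_lt (hab : RankTwoData a b) (hx : Fam a b x) (h : StarStep a b x x' k₀ δ)
    {n : ℕ} (hf : ActsT a b c x (n + 3)) (hn : k₀ ≤ n + 1)
    (hlt : δ (n + 1) = 0 ∨
      coefAt a b (n + 1) * δ (n + 1) - δ n + sigDiff a b x (n + 1) < 0) :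
    ActsT a b c x' (n + 3) ∧ sigT a b x' (n + 3) = sigT a b x (n + 3) ∧
      StarStep a b (x + Finsupp.single (n + 3) 1) (x' + Finsupp.single (n + 3) 1) k₀ δ := by
  have h2 : δ (n + 2) = 0 := by
    rw [h.high n hn]
    split_ifs with h0
    · rfl
    · rcases hlt with h1 | h1
      · exact absurd h1 h0
      · exact max_eq_left h1.le
  have hz : ∀ j, n + 2 ≤ j → δ j = 0 := fun j hj => h.eq_zero_of_le (by omega) h2 hj
  have hs : sigT a b x' (n + 3) = sigT a b x (n + 3) := by
    rw [h.sig_eq (n + 2), hz _ le_rfl, hz (n + 2 + 1) (by omega), hz (n + 2 + 2) (by omega)]; ring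
  have hp := hx.starMax_succ hab hf (by omega)
  have hB := hx.below_of_acts hab hf
  have hd := (hB (n + 2) (by omega) le_rfl).2
  have hβ := hf.sigDiff_neg (k := n + 1) (by omega)
  have hform : starForm a b x (n + 2) + chebDual a b (n + 2) < starMax a b x := by
    rw [starForm_succ]
    rcases hn.lt_or_eq with hlt' | rfl
    · have := h.last _ hlt'
      nlinarith
    · have hB1 := hB (n + 1 + 1) (by omega) le_rfl
      have hc1 := (hB (n + 1) (by omega) (by omega)).1
      rw [h.low _ le_rfl, h.low n (by omega)] at hlt
      have e := cheb_succ_succ (a := a) (b := b) n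
      rcases hlt with h1 | h1
      · omega
      · have h3 : sigDiff a b x (n + 1) ≤ -2 := by
          have : 1 ≤ cheb a b (n + 2) := hB1.1
          omega
        rw [h.attained]
        nlinarith
  refine ⟨h.acts_of hab hx hf (by omega) hf.color hs fun j hj hjc => ?_, hs, h.one_le, ?_, ?_,
    fun j hj => ?_, h.low, fun j hj => ?_, h.bounded, ?_, fun j => ?_⟩
  · rcases Nat.lt_or_ge j n with hjn | hjn
    · exact h.sig_lt hab hx hf (by omega) hjc
    have hne : j ≠ n + 1 := by
      rintro rfl
      have := hf.color
      rw [alt_succ (n + 2), ← hjc] at this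
      simp at this
    obtain rfl : j = n := by omega
    rcases hlt with h1 | h1
    · have h3 := hf.first (j + 1) (by omega) (by omega) hjc
      have h4 := h.nonneg hx hab j
      rw [h.sig_eq, h1, h2]
      change sigT a b x (j + 1) < sigT a b x (j + 3) at h3
      linarith
    · rw [h.sig_eq', h2]; linarith
  · rw [hp]; exact h.pos
  · rw [hp, starForm_add_single, if_neg (by omega), if_neg (by omega), h.attained]; ring
  · rw [hp]; exact h.last_of_add hab hx hf (by omega) hform hj
  · rw [h.high j hj]
    split_ifs with h0
    · rfl
    have hjn : j ≤ n := by
      by_contra hjn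
      exact h0 (hz _ (by omega))
    rw [sigDiff_add_single, if_neg (by omega), if_neg (by omega)]
    split_ifs with e
    · obtain rfl : j = n := by omega
      rcases hlt with h1 | h1
      · exact absurd h1 h0
      · rw [max_eq_left h1.le, max_eq_left (by omega)]
    · simp
  · simp [h.val_zero]
  · simp only [Finsupp.add_apply, h.val]; ring

/-- The invariant behind the recursion for `δ`. -/
lemma starForm_sub (hab : RankTwoData a b) (hx : Fam a b x) (h : StarStep a b x x' k₀ δ) {n : ℕ}
    (hn : k₀ ≤ n + 1) (hδ : 0 < δ (n + 1)) : starForm a b x (n + 1) -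
      chebDual a b (n + 1) * δ (n + 1) + chebDual a b (n + 2) * δ n = starMax a b x - 1 := by
  induction n with
  | zero =>
    obtain rfl : k₀ = 1 := by have := h.one_le; omega
    rw [h.low 1 le_rfl, h.low 0 (by omega), h.attained]
    simp
  | succ n ih =>
    rcases hn.lt_or_eq with hlt | rfl
    · have h0 : 0 < δ (n + 1) := by
        refine lt_of_le_of_ne (h.nonneg hx hab _) fun h0 => ?_
        have := h.eq_zero_of_le (by omega) h0.symm (j := n + 1 + 1) (by omega)
        omega
      have h1 := ih (by omega) h0
      have h2 := h.high n (by omega)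
      rw [if_neg h0.ne'] at h2
      have h3 : δ (n + 2) = coefAt a b (n + 1) * δ (n + 1) - δ n + sigDiff a b x (n + 1) := by
        rcases max_choice 0 (coefAt a b (n + 1) * δ (n + 1) - δ n + sigDiff a b x (n + 1)) with
          h4 | h4
        · rw [h4] at h2; change 0 < δ (n + 2) at hδ; omega
        · rw [h2, h4]
      rw [starForm_succ, chebDual_succ_succ (n + 1), show n + 1 + 1 = n + 2 by ring, h3, ← h1]
      ring
    · rw [h.low _ le_rfl, h.low _ (by omega : n + 1 ≤ n + 1 + 1), h.attained]
      have := cheb_det (a := a) (b := b) (n + 1)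
      linarith

end StarStep

end RankTwo

section RankTwo

variable {a b : ℤ} {x x' : ℕ →₀ ℤ}

namespace StarStep

variable {k₀ : ℕ} {δ : ℕ → ℤ} {c : Bool} {k n : ℕ}

lemma high_eq (h : StarStep a b x x' k₀ δ) (hn : k₀ ≤ n + 1) (hδ : 0 < δ (n + 1))
    (hg : 0 ≤ coefAt a b (n + 1) * δ (n + 1) - δ n + sigDiff a b x (n + 1)) :
    δ (n + 2) = coefAt a b (n + 1) * δ (n + 1) - δ n + sigDiff a b x (n + 1) := by
  rw [h.high n hn, if_neg hδ.ne', max_eq_right hg]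

lemma sigDiff_le (hab : RankTwoData a b) (hx : Fam a b x) (h : StarStep a b x x' k₀ δ)
    (hf : ActsT a b c x (n + 3)) (hn : k₀ ≤ n + 1) (hδ : 0 < δ (n + 1))
    (hg : 0 ≤ coefAt a b (n + 1) * δ (n + 1) - δ n + sigDiff a b x (n + 1))
    (h0 : δ (n + 2) = 0)
    (hcase : Below a b (n + 3) ∨ ¬(k₀ = n + 1 ∧ sigDiff a b x (n + 1) = -1)) :
    sigDiff a b x (n + 2) - δ (n + 1) ≤ 0 := by
  have hB := hx.below_of_acts hab hf
  have e₁ := h.starForm_sub hab hx hn hδ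
  have e₂ := starForm_succ (a := a) (b := b) x (n + 1)
  have e₃ := starForm_succ (a := a) (b := b) x (n + 2)
  have e₄ := chebDual_succ_succ (a := a) (b := b) (n + 1)
  have e₅ := h.high_eq hn hδ hg
  rw [h0] at e₅
  simp only [show n + 1 + 1 = n + 2 by ring, show n + 1 + 2 = n + 3 by ring] at e₂ e₃ e₄
  have e₆ : starForm a b x (n + 2) = starMax a b x - 1 - chebDual a b (n + 3) * δ (n + 1) := by
    have : sigDiff a b x (n + 1) = δ n - coefAt a b (n + 1) * δ (n + 1) := by linarith
    rw [e₂, e₄, this, ← e₁]; ring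
  have hl := h.last (n + 3) (by omega)
  by_cases hB' : Below a b (n + 3)
  · have hd := (hB' (n + 3) (by omega) le_rfl).2
    by_contra hpos
    have : chebDual a b (n + 3) * 1 ≤ chebDual a b (n + 3) * (sigDiff a b x (n + 2) - δ (n + 1)) :=
      mul_le_mul_of_nonneg_left (by omega) hd.le
    linarith
  · have h1 := (hab.eq_one_of_not_below hB hB').2
    rw [(hab.eq_zero_of_not_below hB hB').2] at e₆
    rw [h1] at e₂
    have hβ := hf.sigDiff_neg (k := n + 1) (by omega)
    have hle := starForm_le (a := a) (b := b) x (n + 1)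
    refine absurd ⟨?_, by linarith⟩ (hcase.resolve_left hB')
    by_contra hne
    have := h.last (n + 1) (by omega)
    linarith

lemma step_aux (hab : RankTwoData a b) (hx : Fam a b x) (h : StarStep a b x x' k₀ δ)
    (hf : ActsT a b c x (n + 3)) (hn : k₀ ≤ n + 1) (hδ : 0 < δ (n + 1))
    (hg : 0 ≤ coefAt a b (n + 1) * δ (n + 1) - δ n + sigDiff a b x (n + 1)) {k₁ : ℕ}
    (hk₁ : k₀ ≤ k₁) (hat : starForm a b (x + Finsupp.single (n + 3) 1) k₁ = starMax a b x)
    (hlast : ∀ j, k₁ < j → starForm a b (x + Finsupp.single (n + 3) 1) j < starMax a b x)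
    (hlow : ∀ j, j ≤ k₁ → δ j + (if j = n + 2 then 1 else 0) = cheb a b j)
    (hcase : k₁ ≤ n + 2 → Below a b (n + 3) ∨ ¬(k₀ = n + 1 ∧ sigDiff a b x (n + 1) = -1)) :
    StarStep a b (x + Finsupp.single (n + 3) 1) (x' + Finsupp.single (n + 1) 1) k₁
      (fun j => δ j + if j = n + 2 then 1 else 0) := by
  have hp := hx.starMax_succ hab hf (by omega)
  refine ⟨h.one_le.trans hk₁, ?_, ?_, ?_, hlow, fun j hj => ?_, ?_, ?_, fun j => ?_⟩
  · rw [hp]; exact h.pos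
  · rw [hp]; exact hat
  · rw [hp]; exact hlast
  · rw [sigDiff_add_single]
    have hh := h.high j (hk₁.trans hj)
    rcases lt_trichotomy j n with hjn | rfl | hjn
    · rw [if_neg (by omega : ¬j + 2 = n + 2), if_neg (by omega : ¬j + 1 = n + 2),
        if_neg (by omega : ¬j = n + 2), if_neg (by omega : ¬n + 3 = j + 1),
        if_neg (by omega : ¬n + 3 = j + 1 + 1), if_neg (by omega : ¬n + 3 = j + 1 + 2), hh]
      simp
    · rw [if_pos rfl, if_neg (by omega : ¬j + 1 = j + 2),
        if_neg (by omega : ¬j = j + 2), if_neg (by omega : ¬j + 3 = j + 1),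
        if_neg (by omega : ¬j + 3 = j + 1 + 1), if_pos (by omega : j + 3 = j + 1 + 2),
        h.high_eq hn hδ hg, if_neg (by omega), max_eq_right (by linarith)]
      ring
    rcases (by omega : j = n + 1 ∨ j = n + 2 ∨ n + 2 < j) with rfl | rfl | hjn'
    · rw [if_neg (by omega : ¬n + 1 + 2 = n + 2), if_pos (by omega : n + 1 + 1 = n + 2),
        if_neg (by omega : ¬n + 1 = n + 2), if_pos (by omega : n + 3 = n + 1 + 1 + 1), if_neg (by omega : ¬n + 3 = n + 1 + 1 + 2), hh]
      have h2 := h.nonneg hx hab (n + 1 + 1)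
      rw [if_neg (by omega : ¬δ (n + 1 + 1) + 1 = 0)]
      split_ifs with h0
      · have := h.sigDiff_le hab hx hf hn hδ hg h0 (hcase hj)
        rw [h0, max_eq_left]
        · simp
        · change _ + (sigDiff a b x (n + 2) + 0 - coefAt a b (n + 2) + 0) ≤ _
          change coefAt a b (n + 2) * (0 + 1) - _ + _ ≤ _
          linarith
      · rw [add_zero]
        congr 1
        ring
    · rw [if_neg (by omega : ¬n + 2 + 2 = n + 2), if_neg (by omega : ¬n + 2 + 1 = n + 2),
        if_pos rfl, if_pos (by omega : n + 3 = n + 2 + 1),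
        if_neg (by omega : ¬n + 3 = n + 2 + 1 + 1), if_neg (by omega : ¬n + 3 = n + 2 + 1 + 2), hh]
      simp only [add_zero]
      split_ifs
      · rfl
      · congr 1
        ring
    · rw [if_neg (by omega : ¬j + 2 = n + 2), if_neg (by omega : ¬j + 1 = n + 2),
        if_neg (by omega : ¬j = n + 2), if_neg (by omega : ¬n + 3 = j + 1),
        if_neg (by omega : ¬n + 3 = j + 1 + 1), if_neg (by omega : ¬n + 3 = j + 1 + 2), hh]
      simp
  · obtain ⟨N, hN⟩ := h.bounded
    exact ⟨N + n + 3, fun j hj => by rw [hN j (by omega), if_neg (by omega), add_zero]⟩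
  · simp [h.val_zero]
  · simp only [Finsupp.add_apply, h.val, Finsupp.single_apply]
    split_ifs <;> omega

lemma step_of_sum_nonneg (hab : RankTwoData a b) (hx : Fam a b x) (h : StarStep a b x x' k₀ δ)
    (hf : ActsT a b c x (n + 3)) (hn : k₀ ≤ n + 1) (hδ : 0 < δ (n + 1))
    (hg : 0 ≤ coefAt a b (n + 1) * δ (n + 1) - δ n + sigDiff a b x (n + 1)) :
    ActsT a b c x' (n + 1) ∧ sigT a b x' (n + 1) = sigT a b x (n + 3) ∧
      ∃ k₁ δ', StarStep a b (x + Finsupp.single (n + 3) 1) (x' + Finsupp.single (n + 1) 1) k₁ δ' := by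
  have hs : sigT a b x' (n + 1) = sigT a b x (n + 3) := by
    rw [h.sig_eq', h.high_eq hn hδ hg]; ring
  refine ⟨h.acts_of hab hx hf (by omega) (by rw [← hf.color]; exact (alt_add_two (n + 1)).symm) hs
    fun j hj hjc => h.sig_lt hab hx hf (by omega) hjc, hs, ?_⟩
  have hB := hx.below_of_acts hab hf
  have hd := (hB (n + 2) (by omega) le_rfl).2
  have hβ := hf.sigDiff_neg (k := n + 1) (by omega)
  have e := starForm_succ (a := a) (b := b) x (n + 1)
  have hy : starForm a b (x + Finsupp.single (n + 3) 1) (n + 2) =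
      starForm a b x (n + 2) + chebDual a b (n + 2) := by
    rw [starForm_add_single, if_pos (by omega), if_neg (by omega)]; ring
  by_cases hcase : k₀ = n + 1 ∧ sigDiff a b x (n + 1) = -1
  · obtain ⟨rfl, hβ'⟩ := hcase
    have hat : starForm a b (x + Finsupp.single (n + 3) 1) (n + 2) = starMax a b x := by
      rw [hy, e, hβ', h.attained]; ring
    have hδ' : δ (n + 2) + 1 = cheb a b (n + 2) := by
      rw [h.high_eq hn hδ hg, hβ', h.low _ le_rfl, h.low n (by omega), cheb_succ_succ]; ring
    have hlow : ∀ j, j ≤ n + 2 → δ j + (if j = n + 2 then 1 else 0) = cheb a b j := by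
      intro j hj
      split_ifs with h0
      · rw [h0]; exact hδ'
      · rw [h.low j (by omega), add_zero]
    have hbig : ∀ j, n + 3 < j →
        starForm a b (x + Finsupp.single (n + 3) 1) j < starMax a b x := fun j hj => by
      rw [starForm_add_single, if_neg (by omega), if_neg (by omega)]
      have := h.last j (by omega)
      omega
    by_cases hB' : Below a b (n + 3)
    · refine ⟨n + 2, _, h.step_aux hab hx hf hn hδ hg (by omega) hat (fun j hj => ?_) hlow
        fun _ => .inl hB'⟩
      rcases (by omega : j = n + 3 ∨ n + 3 < j) with rfl | hj'
      · have h1 : 0 ≤ chebDual a b (n + 3 + 1) := (hab.cheb_succ_nonneg hB').2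
        have h2 := h.last (n + 3) (by omega)
        rw [starForm_add_single, if_neg (by omega), if_pos rfl]; omega
      · exact hbig j hj'
    · refine ⟨n + 3, _, h.step_aux hab hx hf hn hδ hg (by omega) ?_ hbig (fun j hj => ?_)
        fun _ => by omega⟩
      · rw [(hx.succ hab hf).starForm_eq_of_not_below hab hB hB']; exact hat
      · rcases (by omega : j = n + 3 ∨ j ≤ n + 2) with rfl | hj'
        · rw [(hab.eq_one_of_not_below hB hB').1] at hδ'
          rw [if_neg (by omega), h.eq_zero_of_le (n := n + 2) (by omega) (by omega) (by omega),
            (hab.eq_zero_of_not_below hB hB').1, add_zero]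
        · exact hlow j hj'
  · refine ⟨k₀, _, h.step_aux hab hx hf hn hδ hg le_rfl ?_ (fun j hj => ?_) (fun j hj => ?_)
      fun _ => .inr hcase⟩
    · rw [starForm_add_single, if_neg (by omega), if_neg (by omega), h.attained]; ring
    · refine h.last_of_add hab hx hf (by omega) ?_ hj
      rw [e]
      rcases hn.lt_or_eq with hlt' | rfl
      · have := h.last _ hlt'
        change _ + chebDual a b (n + 2) * _ + _ < _
        nlinarith
      · have h3 : sigDiff a b x (n + 1) ≤ -2 := by
          have : sigDiff a b x (n + 1) ≠ -1 := fun h' => hcase ⟨rfl, h'⟩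
          omega
        change _ + chebDual a b (n + 2) * _ + _ < _
        rw [h.attained]
        nlinarith
    · rw [h.low j hj, if_neg (by omega), add_zero]

/-- The starred `ẽ` of the second colour commutes with `f̃_c`, except in the degenerate case. -/
lemma step (hab : RankTwoData a b) (hx : Fam a b x) (h : StarStep a b x x' k₀ δ)
    (hf : ActsT a b c x (k + 1)) (hnd : k = 1 → starForm a b x 1 ≠ starMax a b x) :
    ∃ k' k₁ δ', ActsT a b c x' k' ∧ sigT a b x' k' = sigT a b x (k + 1) ∧
      StarStep a b (x + Finsupp.single (k + 1) 1) (x' + Finsupp.single k' 1) k₁ δ' := by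
  have hne := h.pos_ne hab hx hf hnd
  rcases Nat.lt_or_ge (k + 1) k₀ with hk | hk
  · exact ⟨_, _, _, h.step_of_lt hab hx hf hnd hk⟩
  have h1 := h.one_le
  obtain ⟨n, rfl⟩ : ∃ n, k = n + 2 := ⟨k - 2, by omega⟩
  have hn : k₀ ≤ n + 1 := by omega
  by_cases hlt : δ (n + 1) = 0 ∨
      coefAt a b (n + 1) * δ (n + 1) - δ n + sigDiff a b x (n + 1) < 0
  · exact ⟨_, _, _, h.step_of_sum_lt hab hx hf hn hlt⟩
  · push Not at hlt
    obtain ⟨h2, h3, k₁, δ', h4⟩ := h.step_of_sum_nonneg hab hx hf hn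
      (lt_of_le_of_ne (h.nonneg hx hab _) hlt.1.symm) hlt.2
    exact ⟨_, k₁, δ', h2, h3, h4⟩

end StarStep

/-- In the degenerate case the action of `f̃` is undone by the starred `ẽ`. -/
lemma Fam.starStep_two (hab : RankTwoData a b) (hx : Fam a b x) {c : Bool}
    (hf : ActsT a b c x 2) (h1 : starForm a b x 1 = starMax a b x) :
    starMax a b (x + Finsupp.single 2 1) = starMax a b x + 1 ∧
      ∃ k₀ δ, StarStep a b (x + Finsupp.single 2 1) x k₀ δ := by
  have hy := hx.succ hab hf
  have f1 : starForm a b (x + Finsupp.single 2 1) 1 = starMax a b x + 1 := by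
    rw [starForm_add_single, if_pos rfl, if_neg (by omega), h1]; simp
  have hoth : ∀ j, j ≠ 1 → j ≠ 2 →
      starForm a b (x + Finsupp.single 2 1) j ≤ starMax a b x := fun j h1 h2 => by
    rw [starForm_add_single, if_neg (by omega), if_neg (by omega)]
    simpa using starForm_le x j
  have f2 : (Below a b 2 → starForm a b (x + Finsupp.single 2 1) 2 ≤ starMax a b x) ∧
      (¬Below a b 2 → starForm a b (x + Finsupp.single 2 1) 2 = starMax a b x + 1) := by
    refine ⟨fun hB => ?_, fun hB => ?_⟩
    · have h1 : 0 ≤ chebDual a b (2 + 1) := (hab.cheb_succ_nonneg hB).2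
      have h2 := starForm_le (a := a) (b := b) x 2
      rw [starForm_add_single, if_neg (by omega), if_pos rfl]; omega
    · rw [hy.starForm_eq_of_not_below hab below_one hB, f1]
  have hp : starMax a b (x + Finsupp.single 2 1) = starMax a b x + 1 := by
    refine starMax_eq_of (fun j => ?_) ⟨1, f1⟩
    by_cases e1 : j = 1
    · subst e1; exact f1.le
    by_cases e2 : j = 2
    · subst e2
      by_cases hB : Below a b 2
      · have := f2.1 hB; omega
      · exact (f2.2 hB).le
    · have := hoth j e1 e2; omega
  have hpos : 0 ≤ starMax a b x := by
    rw [← hx.starForm_zero (a := a) (b := b)]; exact starForm_le x 0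
  have hhigh : ∀ j : ℕ, Below a b 2 ∨ 1 ≤ j → (if j + 2 = 1 then (1 : ℤ) else 0) =
      if (if j + 1 = 1 then (1 : ℤ) else 0) = 0 then 0 else
      max 0 (coefAt a b (j + 1) * (if j + 1 = 1 then 1 else 0) - (if j = 1 then 1 else 0) +
        sigDiff a b (x + Finsupp.single 2 1) (j + 1)) := by
    intro j hj
    rcases j with _ | j
    · have hB : Below a b 2 := by simpa using hj
      have hd := (hB 2 (by omega) le_rfl).2
      have e := starForm_succ (a := a) (b := b) x 1
      have h2 := starForm_le (a := a) (b := b) x 2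
      have h3 : sigDiff a b x 1 ≤ 0 := by
        by_contra h4
        have := mul_pos hd (not_le.mp h4)
        simp only [Nat.reduceAdd] at e
        omega
      rw [sigDiff_add_single]
      simp
      omega
    · simp
  have hval : ∀ k : ℕ, x (k + 1) = (x + Finsupp.single 2 1 : ℕ →₀ ℤ) (k + 1) +
      (if k + 2 = 1 then (1 : ℤ) else 0) - if k = 1 then 1 else 0 := fun k => by
    rw [Finsupp.add_apply, Finsupp.single_apply]
    split_ifs <;> omega
  refine ⟨hp, ?_⟩
  by_cases hB : Below a b 2
  · refine ⟨1, fun j => if j = 1 then 1 else 0, le_rfl, by omega, by rw [hp, f1], fun j hj => ?_,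
      fun j hj => ?_, fun j _ => hhigh j (.inl hB), ⟨2, fun j hj => if_neg (by omega)⟩, hx.zero,
      hval⟩
    · rw [hp]
      by_cases e2 : j = 2
      · subst e2; have := f2.1 hB; omega
      · have := hoth j (by omega) e2; omega
    · interval_cases j <;> simp
  · refine ⟨2, fun j => if j = 1 then 1 else 0, by omega, by omega, by rw [hp, f2.2 hB],
      fun j hj => ?_, fun j hj => ?_, fun j hj => hhigh j (.inr (by omega)),
      ⟨2, fun j hj => if_neg (by omega)⟩, hx.zero, hval⟩
    · rw [hp]
      have := hoth j (by omega) (by omega); omega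
    · interval_cases j
      · simp
      · simp
      · simpa using (hab.eq_zero_of_not_below below_one hB).1.symm

end RankTwo

section RankTwo

variable {a b : ℤ} {x x' : ℕ →₀ ℤ}

/-- The pairing of the weight of `x` with the coroot of colour `c`. -/
def wtT (a b : ℤ) (c : Bool) (x : ℕ →₀ ℤ) : ℤ := -tailSum (cartanTwo a b) alt c 0 x

lemma wtT_add_single (c : Bool) (x : ℕ →₀ ℤ) (k : ℕ) :
    wtT a b c (x + Finsupp.single k 1) = wtT a b c x - cartanTwo a b c (alt k) := by
  rw [wtT, wtT, tailSum_add, tailSum_single, if_pos (Nat.zero_le k)]; ring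

/-- The jump `ε_c + ε_c^* + ⟨h_c, wt⟩`. -/
def jump (a b : ℤ) (c : Bool) (P : (ℕ →₀ ℤ) → ℤ) (x : ℕ →₀ ℤ) : ℤ :=
  epsT a b c x + P x + wtT a b c x

/-- A starred crystal structure of colour `c`: `P` is `ε_c^*` and `T` is the graph of `ẽ_c^*`. -/
structure StarData (a b : ℤ) (c : Bool) (P : (ℕ →₀ ℤ) → ℤ) (T : (ℕ →₀ ℤ) → (ℕ →₀ ℤ) → Prop) :
    Prop where
  P_zero : P 0 = 0
  pos : ∀ {x x'}, T x x' → 0 < P x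
  functional : ∀ {x y y'}, T x y → T x y' → y = y'
  jump_nonneg : ∀ {x}, Fam a b x → 0 ≤ jump a b c P x
  other : ∀ {x k}, Fam a b x → ActsT a b (!c) x k → P (x + Finsupp.single k 1) = P x ∧
    ∀ x', T x x' → epsT a b (!c) x' = epsT a b (!c) x ∧
      ∃ k', ActsT a b (!c) x' k' ∧ T (x + Finsupp.single k 1) (x' + Finsupp.single k' 1)
  jump_zero : ∀ {x k}, Fam a b x → ActsT a b c x k → jump a b c P x = 0 →
    P (x + Finsupp.single k 1) = P x + 1 ∧ T (x + Finsupp.single k 1) x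
  jump_pos : ∀ {x k}, Fam a b x → ActsT a b c x k → 0 < jump a b c P x →
    P (x + Finsupp.single k 1) = P x ∧
    ∀ x', T x x' → epsT a b c x' = epsT a b c x ∧
      ∃ k', ActsT a b c x' k' ∧ T (x + Finsupp.single k 1) (x' + Finsupp.single k' 1)
  eps_le : ∀ {x x'}, Fam a b x → T x x' → epsT a b c x' ≤ epsT a b c x

lemma wtT_false (hx : Fam a b x) : wtT a b false x = -(starForm a b x 1 + sigT a b x 2) := by
  have h1 := sigT_eq (a := a) (b := b) x 0
  rw [sigT, sig_eq, hx.zero, zero_add, zero_add, show alt 0 = false from rfl] at h1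
  rw [wtT, tailSum_succ, hx.zero, starForm_succ, hx.starForm_zero, zero_add, h1]
  simp

lemma jump_false (hx : Fam a b x) : jump a b false (starMax a b) x =
    (epsT a b false x - sigT a b x 2) + (starMax a b x - starForm a b x 1) := by
  rw [jump, wtT_false hx]; ring

lemma starData_false (hab : RankTwoData a b) :
    StarData a b false (starMax a b) (fun x x' => ∃ k₀ δ, StarStep a b x x' k₀ δ) := by
  have heps : ∀ {x}, sigT a b x 2 ≤ epsT a b false x := fun {x} =>
    sig_le_tailMax alt_infinite x (by omega) rfl
  have hmain : ∀ {c x k}, Fam a b x → ActsT a b c x k →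
      (k = 2 → starForm a b x 1 ≠ starMax a b x) →
      starMax a b (x + Finsupp.single k 1) = starMax a b x ∧
      ∀ x', (∃ k₀ δ, StarStep a b x x' k₀ δ) → epsT a b c x' = epsT a b c x ∧
      ∃ k', ActsT a b c x' k' ∧ ∃ k₀ δ, StarStep a b (x + Finsupp.single k 1)
        (x' + Finsupp.single k' 1) k₀ δ := by
    intro c x k hx hf hnd
    obtain ⟨k, rfl⟩ : ∃ i, k = i + 1 := ⟨k - 1, by have := hf.le; omega⟩
    have hnd' : k = 1 → starForm a b x 1 ≠ starMax a b x := fun h => hnd (by omega)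
    refine ⟨hx.starMax_succ hab hf hnd', ?_⟩
    rintro x' ⟨k₀, δ, h⟩
    obtain ⟨k', k₁, δ', h1, h2, h3⟩ := h.step hab hx hf hnd'
    exact ⟨by rw [epsT, h1.tailMax_eq, epsT, hf.tailMax_eq]; exact h2, k', h1, k₁, δ', h3⟩
  refine ⟨starMax_eq_of (p := 0) (by simp [starForm]) ⟨0, by simp [starForm]⟩, ?_, ?_, fun {x} hx => ?_,
    fun {x k} hx hf => ?_, fun {x k} hx hf h0 => ?_, fun {x k} hx hf h0 => ?_, ?_⟩
  · rintro x x' ⟨k₀, δ, h⟩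
    exact h.pos
  · rintro x y y' ⟨k₀, δ, h⟩ ⟨k₁, δ', h'⟩
    exact h.unique h'
  · rw [jump_false hx]
    have := starForm_le (a := a) (b := b) x 1
    have := heps (x := x)
    omega
  · refine hmain hx hf ?_
    rintro rfl
    exact absurd hf.color (by decide)
  · rw [jump_false hx] at h0
    have h1 := starForm_le (a := a) (b := b) x 1
    have h2 := heps (x := x)
    have h3 : sigT a b x 2 = epsT a b false x := by omega
    have hk : k = 2 := by
      refine hf.unique ⟨by omega, rfl, fun j hj hjc => ?_, fun j hj hlt hjc => ?_⟩
      · change _ ≤ sigT a b x 2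
        rw [h3]; exact sig_le_tailMax alt_infinite x hj hjc
      · interval_cases j
        exact absurd hjc (by decide)
    subst hk
    exact hx.starStep_two hab hf (by omega)
  · refine hmain hx hf ?_
    rintro rfl h1
    rw [jump_false hx, h1, epsT, hf.tailMax_eq] at h0
    simp at h0
  · rintro x x' hx ⟨k₀, δ, h⟩
    exact h.tailMax_le hab hx false

lemma wtT_true (hx : Fam a b x) : wtT a b true x = -(x 1 + sigT a b x 1) := by
  rw [wtT, tailSum_succ, hx.zero, tailSum_succ, sigT, sig_eq, show alt (0 + 1) = true from rfl,
    cartanTwo_self]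
  ring_nf

lemma jump_true (hx : Fam a b x) :
    jump a b true (fun x => x 1) x = epsT a b true x - sigT a b x 1 := by
  rw [jump, wtT_true hx]; ring

lemma starData_true :
    StarData a b true (fun x => x 1) (fun x x' => 0 < x 1 ∧ x = x' + Finsupp.single 1 1) := by
  have heps : ∀ {x}, sigT a b x 1 ≤ epsT a b true x := fun {x} =>
    sig_le_tailMax alt_infinite x le_rfl rfl
  have hs : ∀ (x : ℕ →₀ ℤ) j, 1 < j → sigT a b (x + Finsupp.single 1 1) j = sigT a b x j :=
    fun x j hj => sig_congr j fun i hi => by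
      rw [Finsupp.add_apply, Finsupp.single_apply, if_neg (by omega), add_zero]
  have hmain : ∀ {c x k}, ActsT a b c x k → k ≠ 1 →
      (x + Finsupp.single k 1 : ℕ →₀ ℤ) 1 = x 1 ∧
      ∀ x', 0 < x 1 ∧ x = x' + Finsupp.single 1 1 → epsT a b c x' = epsT a b c x ∧
      ∃ k', ActsT a b c x' k' ∧ 0 < (x + Finsupp.single k 1 : ℕ →₀ ℤ) 1 ∧
        x + Finsupp.single k 1 = x' + Finsupp.single k' 1 + Finsupp.single 1 1 := by
    intro c x k hf hk1
    have e : (x + Finsupp.single k 1 : ℕ →₀ ℤ) 1 = x 1 := by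
      rw [Finsupp.add_apply, Finsupp.single_apply, if_neg hk1, add_zero]
    refine ⟨e, ?_⟩
    rintro x' ⟨h0, rfl⟩
    have hk := hf.le
    have hsk := hs x' k (by omega)
    have h1 : sigT a b (x' + Finsupp.single 1 1) 1 = sigT a b x' 1 + 1 := by
      rw [sigT, sig_add, sig_single, if_pos rfl]
    have hf' : ActsT a b c x' k := by
      refine ⟨hk, hf.color, fun j hj hjc => ?_, fun j hj hlt hjc => ?_⟩
      · have h2 := hf.max j hj hjc
        change sigT a b _ j ≤ sigT a b _ k at h2
        change sigT a b x' j ≤ sigT a b x' k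
        rcases hj.lt_or_eq with hj1 | rfl
        · rw [← hs x' j hj1, ← hsk]; exact h2
        · omega
      · have h2 := hf.first j hj hlt hjc
        change sigT a b _ j < sigT a b _ k at h2
        change sigT a b x' j < sigT a b x' k
        rcases hj.lt_or_eq with hj1 | rfl
        · rw [← hs x' j hj1, ← hsk]; exact h2
        · omega
    refine ⟨?_, k, hf', by rw [e]; exact h0, add_right_comm _ _ _⟩
    rw [epsT, hf'.tailMax_eq, epsT, hf.tailMax_eq]
    exact hsk.symm
  refine ⟨rfl, fun h => h.1, fun h h' => add_right_cancel (h.2.symm.trans h'.2), fun {x} hx => ?_,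
    fun {x k} hx hf => ?_, fun {x k} hx hf h0 => ?_, fun {x k} hx hf h0 => ?_, ?_⟩
  · rw [jump_true hx]
    have := heps (x := x)
    omega
  · refine hmain hf ?_
    rintro rfl
    exact absurd hf.color (by decide)
  · rw [jump_true hx] at h0
    have hk : k = 1 := by
      refine hf.unique ⟨le_rfl, rfl, fun j hj hjc => ?_, fun j hj hlt hjc => by omega⟩
      change _ ≤ sigT a b x 1
      rw [← sub_eq_zero.mp h0]; exact sig_le_tailMax alt_infinite x hj hjc
    subst hk
    have := hx.nonneg 1
    refine ⟨by simp, ?_, rfl⟩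
    simp; omega
  · refine hmain hf ?_
    rintro rfl
    rw [jump_true hx, epsT, hf.tailMax_eq] at h0
    simp at h0
  · rintro x x' hx ⟨h0, rfl⟩
    obtain ⟨k, hk⟩ := exists_actsAt (A := cartanTwo a b) alt_infinite 1 true x'
    rw [epsT, hk.tailMax_eq]
    refine le_trans ?_ (sig_le_tailMax alt_infinite _ hk.le hk.color)
    rw [sig_add, sig_single]
    have := hk.le
    split_ifs <;> omega

namespace StarData

variable {c : Bool} {P : (ℕ →₀ ℤ) → ℤ} {T : (ℕ →₀ ℤ) → (ℕ →₀ ℤ) → Prop}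

/-- `P` and `T` behave as `ε^*` and `ẽ^*` for the starred operator. -/
lemma step_spec (hab : RankTwoData a b) (S : StarData a b c P T) (hx : Fam a b x) :
    0 ≤ P x ∧ (0 < P x → ∃ x', T x x') ∧
    ∀ x', T x x' → Fam a b x' ∧ P x' = P x - 1 ∧
      ∀ d, wtT a b d x' = wtT a b d x + cartanTwo a b d c := by
  have hj : ∀ {x x'}, Fam a b x → P x' = P x - 1 → (∀ d, wtT a b d x' = wtT a b d x +
      cartanTwo a b d c) → epsT a b c x' = epsT a b c x → 0 < jump a b c P x →
      0 < jump a b c P x' := by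
    intro x x' _ h1 h2 h3 h4
    have := h2 c
    rw [cartanTwo_self] at this
    unfold jump at *
    omega
  refine Fam.induction hab (P := fun x => 0 ≤ P x ∧ (0 < P x → ∃ x', T x x') ∧
    ∀ x', T x x' → Fam a b x' ∧ P x' = P x - 1 ∧
      ∀ d, wtT a b d x' = wtT a b d x + cartanTwo a b d c) ?_ ?_ hx
  · refine ⟨S.P_zero.ge, fun h => absurd h (by rw [S.P_zero]; simp), fun x' h => ?_⟩
    have := S.pos h
    rw [S.P_zero] at this
    exact absurd this (lt_irrefl _)
  · rintro x d k hx hf ⟨h0, hex, hT⟩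
    have hcomm : P (x + Finsupp.single k 1) = P x →
        (∀ x', T x x' → ∃ k', ActsT a b d x' k' ∧ P (x' + Finsupp.single k' 1) = P x' ∧
          T (x + Finsupp.single k 1) (x' + Finsupp.single k' 1)) →
        0 ≤ P (x + Finsupp.single k 1) ∧ (0 < P (x + Finsupp.single k 1) →
          ∃ x', T (x + Finsupp.single k 1) x') ∧
        ∀ x', T (x + Finsupp.single k 1) x' → Fam a b x' ∧
          P x' = P (x + Finsupp.single k 1) - 1 ∧
          ∀ d, wtT a b d x' = wtT a b d (x + Finsupp.single k 1) + cartanTwo a b d c := by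
      intro hP hT'
      refine ⟨hP ▸ h0, fun hp => ?_, fun y' hy' => ?_⟩
      · obtain ⟨x', hx'⟩ := hex (hP ▸ hp)
        obtain ⟨k', -, -, h3⟩ := hT' x' hx'
        exact ⟨_, h3⟩
      · obtain ⟨x', hx'⟩ := hex (hP ▸ S.pos hy')
        obtain ⟨k', h1, h2, h3⟩ := hT' x' hx'
        obtain ⟨h4, h5, h6⟩ := hT x' hx'
        rw [S.functional hy' h3]
        refine ⟨h4.succ hab h1, by rw [h2, h5, hP], fun e => ?_⟩
        rw [wtT_add_single, wtT_add_single, h6, h1.color, hf.color]; ring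
    by_cases hd : d = c
    · subst hd
      rcases (S.jump_nonneg hx).eq_or_lt with hz | hp
      · obtain ⟨h1, h2⟩ := S.jump_zero hx hf hz.symm
        refine ⟨by omega, fun _ => ⟨_, h2⟩, fun y' hy' => ?_⟩
        rw [S.functional hy' h2]
        refine ⟨hx, by omega, fun e => ?_⟩
        rw [wtT_add_single, hf.color]; ring
      · obtain ⟨h1, h2⟩ := S.jump_pos hx hf hp
        refine hcomm h1 fun x' hx' => ?_
        obtain ⟨h3, k', h4, h5⟩ := h2 x' hx'
        obtain ⟨h6, h7, h8⟩ := hT x' hx'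
        exact ⟨k', h4, (S.jump_pos h6 h4 (hj hx h7 h8 h3 hp)).1, h5⟩
    · obtain rfl : d = !c := by revert hd; cases d <;> cases c <;> simp
      obtain ⟨h1, h2⟩ := S.other hx hf
      refine hcomm h1 fun x' hx' => ?_
      obtain ⟨h3, k', h4, h5⟩ := h2 x' hx'
      exact ⟨k', h4, (S.other (hT x' hx').1 h4).1, h5⟩

lemma jump_eq (hab : RankTwoData a b) (S : StarData a b c P T) (hx : Fam a b x) (hT : T x x') :
    jump a b c P x = max (jump a b c P x' - 1) 0 := by
  obtain ⟨h1, h2, h3⟩ := (S.step_spec hab hx).2.2 x' hT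
  have h4 := h3 c
  rw [cartanTwo_self] at h4
  have h5 := S.eps_le hx hT
  have h6 := S.jump_nonneg hx
  rcases h6.eq_or_lt with hz | hp
  · rw [← hz, eq_comm, max_eq_right]
    unfold jump at *
    omega
  · obtain ⟨k, hk⟩ := exists_actsAt (A := cartanTwo a b) alt_infinite 1 c x
    have := ((S.jump_pos hx hk hp).2 x' hT).1
    rw [max_eq_left]
    all_goals unfold jump at *; omega

end StarData

end RankTwo

section RankTwo

variable {a b : ℤ} {x z : ℕ →₀ ℤ}

/-- The `n`-th iterate of a relation on sequences. -/
def relIter (T : (ℕ →₀ ℤ) → (ℕ →₀ ℤ) → Prop) : ℕ → (ℕ →₀ ℤ) → (ℕ →₀ ℤ) → Prop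
  | 0, x, z => x = z
  | n + 1, x, z => ∃ y, T x y ∧ relIter T n y z

namespace StarData

variable {c : Bool} {P : (ℕ →₀ ℤ) → ℤ} {T : (ℕ →₀ ℤ) → (ℕ →₀ ℤ) → Prop}

lemma iter_functional (S : StarData a b c P T) {n : ℕ} {z z' : ℕ →₀ ℤ} (h : relIter T n x z)
    (h' : relIter T n x z') : z = z' := by
  induction n generalizing x with
  | zero => exact h.symm.trans h'
  | succ n ih =>
    obtain ⟨y, h1, h2⟩ := h
    obtain ⟨y', h1', h2'⟩ := h'
    obtain rfl := S.functional h1 h1'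
    exact ih h2 h2'

lemma iter_exists (hab : RankTwoData a b) (S : StarData a b c P T) {n : ℕ} (hx : Fam a b x)
    (hn : (n : ℤ) ≤ P x) : ∃ z, relIter T n x z := by
  induction n generalizing x with
  | zero => exact ⟨x, rfl⟩
  | succ n ih =>
    push_cast at hn
    obtain ⟨-, h1, h2⟩ := S.step_spec hab hx
    obtain ⟨y, hy⟩ := h1 (by omega)
    obtain ⟨h3, h4, -⟩ := h2 y hy
    obtain ⟨z, hz⟩ := ih h3 (by omega)
    exact ⟨z, y, hy, hz⟩

lemma iter_spec (hab : RankTwoData a b) (S : StarData a b c P T) {n : ℕ} (hx : Fam a b x)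
    (h : relIter T n x z) : Fam a b z ∧ P z = P x - n ∧
      (∀ d, wtT a b d z = wtT a b d x + n * cartanTwo a b d c) ∧
      epsT a b (!c) z = epsT a b (!c) x ∧ jump a b c P x = max (jump a b c P z - n) 0 := by
  induction n generalizing x with
  | zero =>
    obtain rfl : x = z := h
    have := S.jump_nonneg hx
    refine ⟨hx, by simp, by simp, rfl, ?_⟩
    rw [max_eq_left] <;> simp [this]
  | succ n ih =>
    obtain ⟨y, h1, h2⟩ := h
    obtain ⟨h3, h4, h5⟩ := (S.step_spec hab hx).2.2 y h1
    obtain ⟨h6, h7, h8, h9, h10⟩ := ih h3 h2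
    obtain ⟨k, hk⟩ := exists_actsAt (A := cartanTwo a b) alt_infinite 1 (!c) x
    have h11 := ((S.other hx hk).2 y h1).1
    have h12 := S.jump_eq hab hx h1
    push_cast
    refine ⟨h6, by omega, fun d => ?_, h9.trans h11, by omega⟩
    rw [h8, h5]; ring

lemma iter_other (hab : RankTwoData a b) (S : StarData a b c P T) {n k : ℕ} (hx : Fam a b x)
    (hf : ActsT a b (!c) x k) (h : relIter T n x z) : ∃ k', ActsT a b (!c) z k' ∧
      relIter T n (x + Finsupp.single k 1) (z + Finsupp.single k' 1) := by
  induction n generalizing x k with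
  | zero =>
    obtain rfl : x = z := h
    exact ⟨k, hf, rfl⟩
  | succ n ih =>
    obtain ⟨y, h1, h2⟩ := h
    obtain ⟨-, k₁, h3, h4⟩ := (S.other hx hf).2 y h1
    obtain ⟨k', h5, h6⟩ := ih ((S.step_spec hab hx).2.2 y h1).1 h3 h2
    exact ⟨k', h5, _, h4, h6⟩

lemma iter_self (hab : RankTwoData a b) (S : StarData a b c P T) {n k : ℕ} (hx : Fam a b x)
    (hf : ActsT a b c x k) (hj : 0 < jump a b c P x) (h : relIter T n x z) :
    ∃ k', ActsT a b c z k' ∧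
      relIter T n (x + Finsupp.single k 1) (z + Finsupp.single k' 1) := by
  induction n generalizing x k with
  | zero =>
    obtain rfl : x = z := h
    exact ⟨k, hf, rfl⟩
  | succ n ih =>
    obtain ⟨y, h1, h2⟩ := h
    obtain ⟨-, k₁, h3, h4⟩ := (S.jump_pos hx hf hj).2 y h1
    have := S.jump_eq hab hx h1
    obtain ⟨k', h5, h6⟩ := ih ((S.step_spec hab hx).2.2 y h1).1 h3 (by omega) h2
    exact ⟨k', h5, _, h4, h6⟩

end StarData

/-- The decomposition `x ↦ (χ x, n x)` describing the embedding of the rank two crystal into its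
tensor product with an elementary crystal of colour `c`, with `ε^*_c` truncated at `m`. -/
structure Truncation (a b : ℤ) (c : Bool) (m : ℤ) (χ : (ℕ →₀ ℤ) → (ℕ →₀ ℤ))
    (n : (ℕ →₀ ℤ) → ℤ) : Prop where
  fam : ∀ {x}, Fam a b x → Fam a b (χ x)
  zero : χ 0 = 0
  n_zero : n 0 = 0
  wt : ∀ {x}, Fam a b x → ∀ d, wtT a b d x = wtT a b d (χ x) - n x * cartanTwo a b d c
  eps_other : ∀ {x}, Fam a b x → epsT a b (!c) x = epsT a b (!c) (χ x)
  eps_self : ∀ {x}, Fam a b x →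
    epsT a b c x = max (epsT a b c (χ x)) (n x - m - wtT a b c (χ x))
  other : ∀ {x k}, Fam a b x → ActsT a b (!c) x k → n (x + Finsupp.single k 1) = n x ∧
    ∃ k', ActsT a b (!c) (χ x) k' ∧ χ (x + Finsupp.single k 1) = χ x + Finsupp.single k' 1
  self_left : ∀ {x k}, Fam a b x → ActsT a b c x k →
    epsT a b c (χ x) ≤ n x - m - wtT a b c (χ x) →
    n (x + Finsupp.single k 1) = n x + 1 ∧ χ (x + Finsupp.single k 1) = χ x
  self_right : ∀ {x k}, Fam a b x → ActsT a b c x k →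
    n x - m - wtT a b c (χ x) < epsT a b c (χ x) → n (x + Finsupp.single k 1) = n x ∧
    ∃ k', ActsT a b c (χ x) k' ∧ χ (x + Finsupp.single k 1) = χ x + Finsupp.single k' 1

lemma StarData.exists_truncation {c : Bool} {P : (ℕ →₀ ℤ) → ℤ}
    {T : (ℕ →₀ ℤ) → (ℕ →₀ ℤ) → Prop} (hab : RankTwoData a b) (S : StarData a b c P T) {m : ℤ}
    (hm : 0 ≤ m) : ∃ χ n, Truncation a b c m χ n := by
  have hex : ∀ x, ∃ z, Fam a b x → relIter T (P x - m).toNat x z := fun x => by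
    by_cases hx : Fam a b x
    · obtain ⟨z, hz⟩ := S.iter_exists hab (n := (P x - m).toNat) hx
        (by have := (S.step_spec hab hx).1; omega)
      exact ⟨z, fun _ => hz⟩
    · exact ⟨0, fun h => absurd h hx⟩
  choose χ hχ using hex
  have hχ_eq : ∀ {x z n}, Fam a b x → (P x - m).toNat = n → relIter T n x z → χ x = z := by
    rintro x z n hx rfl hz
    exact S.iter_functional (hχ x hx) hz
  have h0 : (P 0 - m).toNat = 0 := by rw [S.P_zero]; omega
  have hjump : ∀ {x}, Fam a b x → epsT a b c x =
      max (epsT a b c (χ x)) (((P x - m).toNat : ℤ) - m - wtT a b c (χ x)) ∧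
      (epsT a b c (χ x) ≤ ((P x - m).toNat : ℤ) - m - wtT a b c (χ x) →
        jump a b c P x = 0 ∧ m ≤ P x) ∧
      (((P x - m).toNat : ℤ) - m - wtT a b c (χ x) < epsT a b c (χ x) →
        0 < jump a b c P x ∨ P x < m) := by
    intro x hx
    obtain ⟨h1, h2, h3, -, h5⟩ := S.iter_spec hab hx (hχ x hx)
    have h6 := S.jump_nonneg h1
    have h7 := S.jump_nonneg hx
    have h8 := h3 c
    rw [cartanTwo_self] at h8
    unfold jump at *
    omega
  refine ⟨χ, fun x => ((P x - m).toNat : ℤ), fun {x} hx => (S.iter_spec hab hx (hχ x hx)).1,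
    hχ_eq Fam.zero_mem h0 rfl, by simp only [h0]; rfl, fun {x} hx d => ?_,
    fun {x} hx => (S.iter_spec hab hx (hχ x hx)).2.2.2.1.symm, fun {x} hx => (hjump hx).1,
    fun {x k} hx hf => ?_, fun {x k} hx hf h => ?_, fun {x k} hx hf h => ?_⟩
  · rw [(S.iter_spec hab hx (hχ x hx)).2.2.1 d]; ring
  · have hP := (S.other hx hf).1
    obtain ⟨k', h1, h2⟩ := S.iter_other hab hx hf (hχ x hx)
    exact ⟨by simp only [hP], k', h1, hχ_eq (hx.succ hab hf) (by rw [hP]) h2⟩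
  · obtain ⟨h1, h2⟩ := (hjump hx).2.1 h
    obtain ⟨h3, h4⟩ := S.jump_zero hx hf h1
    have h5 : (P (x + Finsupp.single k 1) - m).toNat = (P x - m).toNat + 1 := by omega
    exact ⟨by simp only [h5]; push_cast; rfl, hχ_eq (hx.succ hab hf) h5 ⟨x, h4, hχ x hx⟩⟩
  · by_cases hp : 0 < jump a b c P x
    · have hP := (S.jump_pos hx hf hp).1
      obtain ⟨k', h1, h2⟩ := S.iter_self hab hx hf hp (hχ x hx)
      exact ⟨by simp only [hP], k', h1, hχ_eq (hx.succ hab hf) (by rw [hP]) h2⟩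
    · have hj := S.jump_nonneg hx
      have hPm : P x < m := ((hjump hx).2.2 h).resolve_left hp
      have hP := (S.jump_zero hx hf (by omega)).1
      have e1 : (P x - m).toNat = 0 := by omega
      have e2 : (P (x + Finsupp.single k 1) - m).toNat = 0 := by omega
      have e3 := hχ_eq hx e1 rfl
      have e4 := hχ_eq (hx.succ hab hf) e2 rfl
      refine ⟨by simp only [e1, e2], k, by rw [e3]; exact hf, by rw [e3, e4]⟩

lemma exists_truncation (hab : RankTwoData a b) (c : Bool) {m : ℤ} (hm : 0 ≤ m) :
    ∃ χ n, Truncation a b c m χ n := by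
  cases c
  · exact (starData_false hab).exists_truncation hab hm
  · exact starData_true.exists_truncation hab hm

end RankTwo

section Spreading

variable {S : Type*} {A : S → S → ℤ} {ι : ℕ → S}

lemma tailMax_congr (K : ℕ) (i : S) {x y : ℕ →₀ ℤ} (h : ∀ j, K ≤ j → x j = y j) :
    tailMax A ι K i x = tailMax A ι K i y := by
  unfold tailMax
  congr 1
  exact Set.image_congr fun k hk => sig_congr k fun j hj => h j (hk.1.trans hj)

lemma ActsAt.congr {K k : ℕ} {i : S} {x y : ℕ →₀ ℤ} (h : ∀ j, K ≤ j → x j = y j)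
    (hx : ActsAt A ι K i x k) : ActsAt A ι K i y k := by
  have e : ∀ j, K ≤ j → sig A ι j x = sig A ι j y := fun j hj =>
    sig_congr j fun l hl => h l (hj.trans hl)
  refine ⟨hx.le, hx.color, fun j hj hji => ?_, fun j hj hlt hji => ?_⟩
  · rw [← e j hj, ← e k hx.le]; exact hx.max j hj hji
  · rw [← e j hj, ← e k hx.le]; exact hx.first j hj hlt hji

lemma tailMax_of_ne {K : ℕ} {i : S} (h : ι K ≠ i) (x : ℕ →₀ ℤ) :
    tailMax A ι K i x = tailMax A ι (K + 1) i x := by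
  have : {k | K ≤ k ∧ ι k = i} = {k | K + 1 ≤ k ∧ ι k = i} := by
    ext k
    refine ⟨fun hk => ⟨?_, hk.2⟩, fun hk => ⟨by have := hk.1; omega, hk.2⟩⟩
    rcases hk.1.lt_or_eq with hl | rfl
    · exact hl
    · exact absurd hk.2 h
  rw [tailMax, tailMax, this]

lemma ActsAt.of_ne {K k : ℕ} {i : S} {x : ℕ →₀ ℤ} (h : ι K ≠ i)
    (hx : ActsAt A ι (K + 1) i x k) : ActsAt A ι K i x k := by
  have e : ∀ j, K ≤ j → ι j = i → K + 1 ≤ j := fun j hj hji => by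
    rcases hj.lt_or_eq with hl | rfl
    · exact hl
    · exact absurd hji h
  exact ⟨(Nat.le_succ K).trans hx.le, hx.color, fun j hj hji => hx.max j (e j hj hji) hji,
    fun j hj hlt hji => hx.first j (e j hj hji) hlt hji⟩

lemma ActsAt.of_lt {K k : ℕ} {i : S} {x : ℕ →₀ ℤ} (hx : ActsAt A ι (K + 1) i x k)
    (h : sig A ι K x < tailMax A ι (K + 1) i x) : ActsAt A ι K i x k := by
  rw [hx.tailMax_eq] at h
  refine ⟨(Nat.le_succ K).trans hx.le, hx.color, fun j hj hji => ?_, fun j hj hlt hji => ?_⟩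
  · rcases hj.lt_or_eq with hl | rfl
    · exact hx.max j hl hji
    · exact h.le
  · rcases hj.lt_or_eq with hl | rfl
    · exact hx.first j hl hlt hji
    · exact h

lemma actsAt_self (hι : ∀ i : S, {k : ℕ | 1 ≤ k ∧ ι k = i}.Infinite) {K : ℕ} {i : S}
    {x : ℕ →₀ ℤ} (hK : ι K = i) (h : tailMax A ι (K + 1) i x ≤ sig A ι K x) :
    ActsAt A ι K i x K := by
  refine ⟨le_rfl, hK, fun j hj hji => ?_, fun j hj hlt _ => absurd hlt (not_lt.mpr hj)⟩
  rcases hj.lt_or_eq with hl | rfl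
  · exact (sig_le_tailMax hι x hl hji).trans h
  · exact le_rfl

lemma tailMax_of_eq (hι : ∀ i : S, {k : ℕ | 1 ≤ k ∧ ι k = i}.Infinite) {K : ℕ} {i : S}
    (hK : ι K = i) (x : ℕ →₀ ℤ) :
    tailMax A ι K i x = max (tailMax A ι (K + 1) i x) (sig A ι K x) := by
  rcases le_or_gt (tailMax A ι (K + 1) i x) (sig A ι K x) with h | h
  · rw [(actsAt_self hι hK h).tailMax_eq, max_eq_right h]
  · obtain ⟨k, hk⟩ := exists_actsAt (A := A) hι (K + 1) i x
    rw [(hk.of_lt h).tailMax_eq, max_eq_left h.le, hk.tailMax_eq]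

/-- `ψ` identifies the rank two crystal with the component of `z` in the crystal of sequences,
where only the positions `≥ K` are taken into account. -/
structure Spread (A : S → S → ℤ) (ι : ℕ → S) (a b : ℤ) (col : Bool → S) (z : ℕ →₀ ℤ) (K : ℕ)
    (ψ : (ℕ →₀ ℤ) → (ℕ →₀ ℤ)) : Prop where
  zero : ψ 0 = z
  low : ∀ {x}, Fam a b x → ∀ j, j < K → ψ x j = z j
  tail : ∀ {x}, Fam a b x → ∀ c,
    tailSum A ι (col c) K (ψ x) = tailSum A ι (col c) K z - wtT a b c x
  max : ∀ {x}, Fam a b x → ∀ c, tailMax A ι K (col c) (ψ x) = epsT a b c x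
  step : ∀ {x c k}, Fam a b x → ActsT a b c x k →
    ∃ q, ActsAt A ι K (col c) (ψ x) q ∧ ψ (x + Finsupp.single k 1) = ψ x + Finsupp.single q 1

variable {a b : ℤ} {col : Bool → S} {z : ℕ →₀ ℤ} {K : ℕ} {ψ : (ℕ →₀ ℤ) → (ℕ →₀ ℤ)}

lemma Spread.pred_of_ne (h : Spread A ι a b col z (K + 1) ψ) (hK : ∀ c, ι K ≠ col c) :
    Spread A ι a b col z K ψ := by
  refine ⟨h.zero, fun {x} hx j hj => h.low hx j (by omega), fun {x} hx c => ?_,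
    fun {x} hx c => ?_, fun {x c k} hx hf => ?_⟩
  · rw [tailSum_succ, h.tail hx, h.low hx K (by omega), tailSum_succ _ K z]; ring
  · rw [tailMax_of_ne (hK c), h.max hx]
  · obtain ⟨q, h1, h2⟩ := h.step hx hf
    exact ⟨q, h1.of_ne (hK c), h2⟩

lemma color_ne (hab : RankTwoData a b)
    (hcol : ∀ c d, A (col c) (col d) = cartanTwo a b c d) (c : Bool) : col c ≠ col (!c) := by
  intro h
  have h1 := hcol c c
  have h2 := hcol c (!c)
  rw [← h, h1, cartanTwo_self] at h2
  have := hab.a_nonneg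
  have := hab.b_nonneg
  cases c <;> simp [cartanTwo] at h2 <;> omega

lemma Spread.pred_of_eq (hι : ∀ i : S, {k : ℕ | 1 ≤ k ∧ ι k = i}.Infinite)
    (hab : RankTwoData a b) (hcol : ∀ c d, A (col c) (col d) = cartanTwo a b c d)
    (h : Spread A ι a b col z (K + 1) ψ) {c : Bool} (hK : ι K = col c) (hz : sig A ι K z ≤ 0) :
    ∃ ψ', Spread A ι a b col z K ψ' := by
  obtain ⟨χ, n, ht⟩ := exists_truncation hab c (m := -sig A ι K z) (by omega)
  have hne : ι K ≠ col (!c) := hK ▸ color_ne hab hcol c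
  have hcongr : ∀ (y : ℕ →₀ ℤ) (t : ℤ) j, K + 1 ≤ j → y j = (y + Finsupp.single K t) j := by
    intro y t j hj
    rw [Finsupp.add_apply, Finsupp.single_apply, if_neg (by omega), add_zero]
  have hsig : ∀ {x}, Fam a b x → sig A ι K (ψ (χ x) + Finsupp.single K (n x)) =
      n x - (-sig A ι K z) - wtT a b c (χ x) := by
    intro x hx
    have h1 := h.tail (ht.fam hx) c
    rw [sig_add, sig_single, if_pos rfl, sig_eq, h.low (ht.fam hx) K (by omega), hK, h1,
      sig_eq K z, hK]
    ring
  have hmax : ∀ {x}, Fam a b x → ∀ d, tailMax A ι (K + 1) (col d)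
      (ψ (χ x) + Finsupp.single K (n x)) = epsT a b d (χ x) := by
    intro x hx d
    rw [← tailMax_congr (K + 1) (col d) (hcongr (ψ (χ x)) (n x)), h.max (ht.fam hx)]
  have hcases : ∀ d, d = c ∨ d = !c := by intro d; cases d <;> cases c <;> simp
  refine ⟨fun x => ψ (χ x) + Finsupp.single K (n x), ?_, fun {x} hx j hj => ?_,
    fun {x} hx d => ?_, fun {x} hx d => ?_, fun {x d k} hx hf => ?_⟩
  · rw [ht.zero, ht.n_zero, h.zero, Finsupp.single_zero, add_zero]
  · rw [Finsupp.add_apply, Finsupp.single_apply, if_neg (by omega), add_zero,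
      h.low (ht.fam hx) j (by omega)]
  · rw [tailSum_add, tailSum_single, if_pos le_rfl, tailSum_succ, h.low (ht.fam hx) K (by omega),
      h.tail (ht.fam hx), ht.wt hx, tailSum_succ _ K z, hK, hcol]
    ring
  · rcases hcases d with rfl | rfl
    · rw [tailMax_of_eq hι hK, hmax hx, hsig hx, ht.eps_self hx]
    · rw [tailMax_of_ne hne, hmax hx, ht.eps_other hx]
  · rcases hcases d with rfl | rfl
    · rcases le_or_gt (epsT a b d (χ x)) (n x - (-sig A ι K z) - wtT a b d (χ x)) with hl | hl
      · obtain ⟨h1, h2⟩ := ht.self_left hx hf hl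
        refine ⟨K, actsAt_self hι hK (by rw [hmax hx, hsig hx]; exact hl), ?_⟩
        rw [h1, h2, Finsupp.single_add, add_assoc]
      · obtain ⟨h1, k', h2, h3⟩ := ht.self_right hx hf hl
        obtain ⟨q, h4, h5⟩ := h.step (ht.fam hx) h2
        refine ⟨q, (h4.congr (hcongr _ (n x))).of_lt (by rw [hmax hx, hsig hx]; exact hl), ?_⟩
        rw [h1, h3, h5, add_right_comm]
    · obtain ⟨h1, k', h2, h3⟩ := ht.other hx hf
      obtain ⟨q, h4, h5⟩ := h.step (ht.fam hx) h2
      refine ⟨q, (h4.congr (hcongr _ (n x))).of_ne hne, ?_⟩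
      rw [h1, h3, h5, add_right_comm]

lemma exists_positions (hι : ∀ i : S, {k : ℕ | 1 ≤ k ∧ ι k = i}.Infinite) (col : Bool → S)
    (p₀ : ℕ) : ∃ p : ℕ → ℕ, p 0 = p₀ ∧ ∀ k, p k < p (k + 1) ∧
      ι (p (k + 1)) = col (alt (k + 1)) ∧
      ∀ q, p k < q → q < p (k + 1) → ι q ≠ col (alt (k + 1)) := by
  classical
  have hnext : ∀ k r, ∃ q, r < q ∧ ι q = col (alt (k + 1)) ∧
      ∀ q', r < q' → q' < q → ι q' ≠ col (alt (k + 1)) := by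
    intro k r
    have hex : ∃ q, r < q ∧ ι q = col (alt (k + 1)) := by
      obtain ⟨q, h1, h2⟩ := exists_color_ge hι (col (alt (k + 1))) (r + 1)
      exact ⟨q, h1, h2⟩
    exact ⟨Nat.find hex, (Nat.find_spec hex).1, (Nat.find_spec hex).2,
      fun q' h1 h2 h3 => Nat.find_min hex h2 ⟨h1, h3⟩⟩
  choose f hf using hnext
  exact ⟨fun k => Nat.rec p₀ f k, rfl, fun k => hf k _⟩

lemma tailSum_mapDomain {p : ℕ → ℕ} (hcol : ∀ c d, A (col c) (col d) = cartanTwo a b c d)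
    (hp : ∀ j, 1 ≤ j → ι (p j) = col (alt j)) {q k : ℕ} (hk : 1 ≤ k)
    (hq : ∀ j, q ≤ p j ↔ k ≤ j) (c : Bool) (x : ℕ →₀ ℤ) :
    tailSum A ι (col c) q (x.mapDomain p) = tailSum (cartanTwo a b) alt c k x := by
  induction x using Finsupp.induction_linear with
  | zero => simp
  | add f g hf hg => rw [Finsupp.mapDomain_add, tailSum_add, tailSum_add, hf, hg]
  | single j t =>
    rw [Finsupp.mapDomain_single, tailSum_single, tailSum_single]
    simp only [hq]
    split_ifs with h
    · rw [hp j (by omega), hcol]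
    · rfl

lemma exists_spread_of_large (hι : ∀ i : S, {k : ℕ | 1 ≤ k ∧ ι k = i}.Infinite)
    (hab : RankTwoData a b) (hcol : ∀ c d, A (col c) (col d) = cartanTwo a b c d)
    (hK : 1 ≤ K) (hz : ∀ j, K ≤ j → z j = 0)
    (hfirst : ∀ q, K ≤ q → ι q = col false → ∃ r, K ≤ r ∧ r < q ∧ ι r = col true) :
    ∃ ψ, Spread A ι a b col z K ψ := by
  obtain ⟨p, hp0, hp⟩ := exists_positions hι col (K - 1)
  have hmono : StrictMono p := strictMono_nat_of_lt_succ fun k => (hp k).1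
  have hcolor : ∀ j, 1 ≤ j → ι (p j) = col (alt j) := by
    intro j hj
    obtain ⟨j, rfl⟩ : ∃ i, j = i + 1 := ⟨j - 1, by omega⟩
    exact (hp j).2.1
  have hinj : ∀ c d, col c = col d → c = d := by
    intro c d h
    have := color_ne hab hcol c
    by_contra hcd
    exact this (h.trans (by congr 1; revert hcd; cases c <;> cases d <;> simp))
  have hzsum : ∀ q c, K ≤ q → tailSum A ι (col c) q z = 0 := fun q c hq =>
    tailSum_eq_zero _ _ fun j hj => hz j (hq.trans hj)
  have hle : ∀ j, 1 ≤ j → K ≤ p j := by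
    intro j hj
    have := hmono (show 0 < j by omega)
    omega
  have hsig : ∀ (x : ℕ →₀ ℤ) k, 1 ≤ k → sig A ι (p k) (z + x.mapDomain p) = sigT a b x k := by
    intro x k hk
    rw [sig_add, sig_of_large hz (hle k hk), zero_add, sig_eq,
      Finsupp.mapDomain_apply hmono.injective, hcolor k hk,
      tailSum_mapDomain hcol hcolor (k := k + 1) (by omega) (fun j => ?_), sigT, sig_eq]
    rw [Nat.succ_le_iff, hmono.lt_iff_lt, Nat.succ_le_iff]
  have hsig' : ∀ {x}, Fam a b x → ∀ q c, K ≤ q → ι q = col c → ∃ k, 1 ≤ k ∧ p k ≤ q ∧ alt k = c ∧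
      sig A ι q (z + x.mapDomain p) ≤ sigT a b x k := by
    classical
    intro x hx q c hq hqc
    have hp1 : p 1 ≤ q := by
      have key : ∀ q, K ≤ q → ι q = col true → p 1 ≤ q := fun q hq hqc => by
        by_contra hlt
        exact (hp 0).2.2 q (by omega) (by simpa using hlt) hqc
      cases c
      · obtain ⟨r, h1, h2, h3⟩ := hfirst q hq hqc
        exact (key r h1 h3).trans h2.le
      · exact key q hq hqc
    have hex : ∃ j, q < p j := ⟨q + 1, hmono.le_apply⟩
    obtain ⟨k, hk⟩ : ∃ k, Nat.find hex = k + 1 :=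
      ⟨Nat.find hex - 1, by
        have : Nat.find hex ≠ 0 := fun h0 => by
          have := Nat.find_spec hex
          rw [h0] at this
          omega
        omega⟩
    have hk2 : q < p (k + 1) := hk ▸ Nat.find_spec hex
    have hk1 : p k ≤ q := not_lt.mp (Nat.find_min hex (by omega))
    have hk0 : 1 ≤ k := by
      by_contra h0
      obtain rfl : k = 0 := by omega
      simp only [zero_add] at hk2
      omega
    refine ⟨k, hk0, hk1, ?_⟩
    rcases hk1.eq_or_lt with rfl | hk1
    · exact ⟨hinj _ _ ((hcolor k hk0).symm.trans hqc), (hsig x k hk0).le⟩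
    · have hc : alt k = c := by
        have h1 : c ≠ alt (k + 1) := fun h1 => (hp k).2.2 q hk1 hk2 (h1 ▸ hqc)
        rw [alt_succ] at h1
        revert h1
        cases c <;> cases alt k <;> simp
      refine ⟨hc, ?_⟩
      have hnot : q ∉ Set.range p := by
        rintro ⟨j, rfl⟩
        have h1 := hmono.lt_iff_lt.mp hk1
        have h2 := hmono.lt_iff_lt.mp hk2
        omega
      rw [sig_add, sig_of_large hz hq, zero_add, sig_eq, Finsupp.mapDomain_of_notMem_range _ _ hnot,
        hqc, tailSum_mapDomain hcol hcolor (k := k + 1) (by omega) (fun j => ?_), sigT, sig_eq, hc]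
      · have := hx.nonneg k
        omega
      · refine ⟨fun hj => ?_, fun hj => hk2.trans_le (hmono.monotone hj)⟩
        exact hmono.lt_iff_lt.mp (hk1.trans hj)
  have hacts : ∀ {x c k}, Fam a b x → ActsT a b c x k →
      ActsAt A ι K (col c) (z + x.mapDomain p) (p k) := by
    intro x c k hx hf
    refine ⟨hle k hf.le, by rw [hcolor k hf.le, hf.color], fun q hq hqc => ?_,
      fun q hq hlt hqc => ?_⟩
    · obtain ⟨k', h1, -, h3, h4⟩ := hsig' hx q c hq hqc
      rw [hsig x k hf.le]
      exact h4.trans (hf.max k' h1 h3)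
    · obtain ⟨k', h1, h2, h3, h4⟩ := hsig' hx q c hq hqc
      rw [hsig x k hf.le]
      exact h4.trans_lt (hf.first k' h1 (hmono.lt_iff_lt.mp (h2.trans_lt hlt)) h3)
  refine ⟨fun x => z + x.mapDomain p, by simp, fun {x} hx j hj => ?_, fun {x} hx c => ?_,
    fun {x} hx c => ?_, fun {x c k} hx hf => ⟨p k, hacts hx hf, ?_⟩⟩
  · have : x.mapDomain p j = 0 := by
      by_cases hr : j ∈ Set.range p
      · obtain ⟨i, rfl⟩ := hr
        rw [Finsupp.mapDomain_apply hmono.injective]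
        rcases Nat.eq_zero_or_pos i with rfl | hi
        · exact hx.zero
        · have := hle i hi
          omega
      · exact Finsupp.mapDomain_of_notMem_range _ _ hr
    rw [Finsupp.add_apply, this, add_zero]
  · rw [tailSum_add, tailSum_mapDomain hcol hcolor (k := 1) le_rfl (fun j => ?_), wtT,
      tailSum_succ _ 0 x, hx.zero]
    · ring
    · refine ⟨fun hj => ?_, hle j⟩
      by_contra h0
      obtain rfl : j = 0 := by omega
      omega
  · obtain ⟨k, hk⟩ := exists_actsAt (A := cartanTwo a b) alt_infinite 1 c x
    rw [(hacts hx hk).tailMax_eq, epsT, hk.tailMax_eq, hsig x k hk.le]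
  · rw [Finsupp.mapDomain_add, Finsupp.mapDomain_single, add_assoc]

/-- A highest weight vector for two colours generates a copy of the rank two crystal. -/
lemma exists_spread (hι : ∀ i : S, {k : ℕ | 1 ≤ k ∧ ι k = i}.Infinite)
    (hdiag : ∀ i, A i i = 2) (hoff : ∀ i j, i ≠ j → A i j ≤ 0)
    (hzero : ∀ i j, A i j = 0 ↔ A j i = 0) {i j : S} (hij : i ≠ j) {z : ℕ →₀ ℤ}
    (hz : ∀ k, 1 ≤ k → ι k = i ∨ ι k = j → sig A ι k z ≤ 0) :
    ∃ a b col ψ, RankTwoData a b ∧ (∀ k, k = i ∨ k = j ↔ ∃ c, k = col c) ∧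
      Spread A ι a b col z 1 ψ := by
  obtain ⟨N, hN⟩ := exists_bound z
  have main : ∀ (i j : S), i ≠ j → (∀ k, 1 ≤ k → ι k = i ∨ ι k = j → sig A ι k z ≤ 0) →
      (∀ q, N + 1 ≤ q → ι q = j → ∃ r, N + 1 ≤ r ∧ r < q ∧ ι r = i) →
      ∃ a b col ψ, RankTwoData a b ∧ (∀ k, k = i ∨ k = j ↔ ∃ c, k = col c) ∧
        Spread A ι a b col z 1 ψ := by
    intro i j hij hz hfirst
    have hab : RankTwoData (-A i j) (-A j i) :=
      ⟨by have := hoff i j hij; omega, by have := hoff j i hij.symm; omega,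
        by rw [neg_eq_zero, neg_eq_zero]; exact hzero i j⟩
    have hcol : ∀ c d, A (cond c i j) (cond d i j) = cartanTwo (-A i j) (-A j i) c d := by
      intro c d
      cases c <;> cases d <;> simp [cartanTwo, hdiag]
    have hrange : ∀ k, k = i ∨ k = j ↔ ∃ c, k = cond c i j := by
      intro k
      simp [or_comm]
    refine ⟨-A i j, -A j i, fun c => cond c i j, ?_⟩
    suffices h : ∀ M, M ≤ N → ∃ ψ, Spread A ι (-A i j) (-A j i) (fun c => cond c i j) z
        (N + 1 - M) ψ by
      obtain ⟨ψ, hψ⟩ := h N le_rfl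
      rw [Nat.add_sub_cancel_left] at hψ
      exact ⟨ψ, hab, hrange, hψ⟩
    intro M hM
    induction M with
    | zero => exact exists_spread_of_large hι hab hcol (by omega) (fun l hl => hN l (by omega)) hfirst
    | succ M ih =>
      obtain ⟨ψ, hψ⟩ := ih (by omega)
      rw [show N + 1 - M = N + 1 - (M + 1) + 1 by omega] at hψ
      by_cases hc : ∃ c, ι (N + 1 - (M + 1)) = cond c i j
      · obtain ⟨c, hc'⟩ := hc
        exact hψ.pred_of_eq hι hab hcol hc' (hz _ (by omega) ((hrange _).mpr ⟨c, hc'⟩))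
      · push Not at hc
        exact ⟨ψ, hψ.pred_of_ne hc⟩
  by_cases hfirst : ∀ q, N + 1 ≤ q → ι q = j → ∃ r, N + 1 ≤ r ∧ r < q ∧ ι r = i
  · exact main i j hij hz hfirst
  · push Not at hfirst
    obtain ⟨q, hq, hqj, hr⟩ := hfirst
    obtain ⟨a, b, col, ψ, h1, h2, h3⟩ := main j i hij.symm (fun k hk h => hz k hk h.symm)
      fun q' hq' hq'i => ⟨q, hq, by
        by_contra hlt
        rcases (not_lt.mp hlt).eq_or_lt with rfl | hlt
        · exact hij (hq'i.symm.trans hqj)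
        · exact hr q' hq' hlt hq'i, hqj⟩
    exact ⟨a, b, col, ψ, h1, fun k => or_comm.trans (h2 k), h3⟩

end Spreading

section Polytope

variable {S : Type*} {A : S → S → ℤ} {ι : ℕ → S} {x y z : ℕ →₀ ℤ}

/-- `x` is obtained from `z` by applying operators `f̃_i` and `f̃_j`. -/
inductive Reach (A : S → S → ℤ) (ι : ℕ → S) (i j : S) (z : ℕ →₀ ℤ) : (ℕ →₀ ℤ) → Prop
  | refl : Reach A ι i j z z
  | step {x : ℕ →₀ ℤ} {k : S} : k = i ∨ k = j → Reach A ι i j z x →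
      Reach A ι i j z (ftilInf A ι k x)

lemma zero_mem_FInf : (0 : ℕ →₀ ℤ) ∈ FInf A ι := ⟨[], rfl⟩

lemma ftilInf_mem_FInf (i : S) (hx : x ∈ FInf A ι) : ftilInf A ι i x ∈ FInf A ι := by
  obtain ⟨l, rfl⟩ := hx
  exact ⟨l ++ [i], by simp⟩

lemma FInf_cases (hx : x ∈ FInf A ι) : x = 0 ∨ ∃ y ∈ FInf A ι, ∃ i, x = ftilInf A ι i y := by
  obtain ⟨l, rfl⟩ := hx
  rcases l.eq_nil_or_concat with rfl | ⟨l, i, rfl⟩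
  · exact Or.inl rfl
  · exact Or.inr ⟨_, ⟨l, rfl⟩, i, by simp⟩

lemma FInf_induction {P : (ℕ →₀ ℤ) → Prop} (h0 : P 0)
    (hs : ∀ x i, x ∈ FInf A ι → P x → P (ftilInf A ι i x)) (hx : x ∈ FInf A ι) : P x := by
  obtain ⟨l, rfl⟩ := hx
  induction l using List.reverseRecOn with
  | nil => exact h0
  | append_singleton l i ih =>
    rw [List.foldl_append]
    exact hs _ i ⟨l, rfl⟩ ih

lemma FInf_nonneg (hι : ∀ i : S, {k : ℕ | 1 ≤ k ∧ ι k = i}.Infinite) (hx : x ∈ FInf A ι) :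
    x 0 = 0 ∧ ∀ k, 0 ≤ x k := by
  refine FInf_induction (P := fun x => x 0 = 0 ∧ ∀ k, 0 ≤ x k) ⟨rfl, fun k => le_rfl⟩ ?_ hx
  rintro x i - ⟨h0, h⟩
  obtain ⟨q, h1, h2⟩ := exists_ftilInf_eq (A := A) hι i x
  have := h1.le
  rw [h2]
  refine ⟨by rw [Finsupp.add_apply, Finsupp.single_apply, if_neg (by omega), h0, add_zero],
    fun k => ?_⟩
  rw [Finsupp.add_apply, Finsupp.single_apply]
  have := h k
  split_ifs <;> omega

lemma height_ftilInf (hι : ∀ i : S, {k : ℕ | 1 ≤ k ∧ ι k = i}.Infinite) (i : S)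
    (x : ℕ →₀ ℤ) : height (ftilInf A ι i x) = height x + 1 := by
  obtain ⟨q, -, h⟩ := exists_ftilInf_eq (A := A) hι i x
  rw [h, height_add_single]

lemma Reach.mem_FInf {i j : S} (hz : z ∈ FInf A ι) (h : Reach A ι i j z x) : x ∈ FInf A ι := by
  induction h with
  | refl => exact hz
  | step _ _ ih => exact ftilInf_mem_FInf _ ih

/-- In the string component of a vector that is highest for both colours, every element with
`ε_k > 0` is in the image of `f̃_k`. -/
lemma Reach.exists_pred (hι : ∀ i : S, {k : ℕ | 1 ≤ k ∧ ι k = i}.Infinite)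
    (hdiag : ∀ i, A i i = 2) (hoff : ∀ i j, i ≠ j → A i j ≤ 0)
    (hzero : ∀ i j, A i j = 0 ↔ A j i = 0) {i j : S} (hij : i ≠ j)
    (hzi : sigMax A ι i z ≤ 0) (hzj : sigMax A ι j z ≤ 0) (h : Reach A ι i j z x)
    (hx : 0 < sigMax A ι i x) : ∃ y, Reach A ι i j z y ∧ ftilInf A ι i y = x := by
  obtain ⟨a, b, col, ψ, hab, hcol, hψ⟩ := exists_spread (z := z) hι hdiag hoff hzero hij
    fun k hk hc => by
      rcases hc with hc | hc
      · exact (sig_le_tailMax hι z hk hc).trans hzi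
      · exact (sig_le_tailMax hι z hk hc).trans hzj
  have hstep : ∀ {u c k}, Fam a b u → ActsT a b c u k →
      ftilInf A ι (col c) (ψ u) = ψ (u + Finsupp.single k 1) := by
    intro u c k hu hf
    obtain ⟨q, h1, h2⟩ := hψ.step hu hf
    rw [h1.ftilInf_eq, h2]
  have himage : ∀ {x}, Reach A ι i j z x → ∃ u, Fam a b u ∧ ψ u = x := by
    intro x h
    induction h with
    | refl => exact ⟨0, Fam.zero_mem, hψ.zero⟩
    | step hk _ ih =>
      obtain ⟨u, hu, rfl⟩ := ih
      obtain ⟨c, rfl⟩ := (hcol _).mp hk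
      obtain ⟨k, hf⟩ := exists_actsAt (A := cartanTwo a b) alt_infinite 1 c u
      exact ⟨_, hu.succ hab hf, (hstep hu hf).symm⟩
  have hreach : ∀ {u}, Fam a b u → Reach A ι i j z (ψ u) := by
    intro u hu
    refine Fam.induction hab (P := fun u => Reach A ι i j z (ψ u)) ?_ ?_ hu
    · rw [hψ.zero]; exact Reach.refl
    · intro u c k hu hf ih
      rw [← hstep hu hf]
      exact ih.step ((hcol _).mpr ⟨c, rfl⟩)
  obtain ⟨u, hu, rfl⟩ := himage h
  obtain ⟨c, rfl⟩ := (hcol i).mp (Or.inl rfl)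
  rw [sigMax_eq_tailMax, hψ.max hu] at hx
  obtain ⟨v, k, hv, hf, rfl⟩ := hu.exists_pred hab hx
  exact ⟨ψ v, hreach hv, hstep hv hf⟩

/-- `F(∞)` is closed under the operators `ẽ_i`. -/
lemma FInf_exists_pred (hι : ∀ i : S, {k : ℕ | 1 ≤ k ∧ ι k = i}.Infinite)
    (hdiag : ∀ i, A i i = 2) (hoff : ∀ i j, i ≠ j → A i j ≤ 0)
    (hzero : ∀ i j, A i j = 0 ↔ A j i = 0) {i : S} (hx : x ∈ FInf A ι)
    (hi : 0 < sigMax A ι i x) : ∃ y ∈ FInf A ι, ftilInf A ι i y = x := by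
  induction hn : (height x).toNat using Nat.strong_induction_on generalizing x i with
  | _ n ih =>
    rcases FInf_cases hx with rfl | ⟨y, hy, j, rfl⟩
    · obtain ⟨k, hk⟩ := exists_actsAt (A := A) hι 1 i 0
      rw [sigMax_eq_tailMax, hk.tailMax_eq, sig_zero] at hi
      exact absurd hi (lt_irrefl _)
    by_cases hij : i = j
    · exact ⟨y, hy, hij ▸ rfl⟩
    have hheight : ∀ {y} k, y ∈ FInf A ι →
        (height y).toNat < (height (ftilInf A ι k y)).toNat := by
      intro y k hy
      rw [height_ftilInf hι]
      have := height_nonneg (FInf_nonneg hι hy).2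
      omega
    have hdesc : ∀ m, ∀ y ∈ FInf A ι, (height y).toNat = m → m < n → ∃ z ∈ FInf A ι,
        sigMax A ι i z ≤ 0 ∧ sigMax A ι j z ≤ 0 ∧ Reach A ι i j z y := by
      intro m
      induction m using Nat.strong_induction_on with
      | _ m ihm =>
        intro y hy hym hmn
        have hdown : ∀ k, k = i ∨ k = j → 0 < sigMax A ι k y → ∃ z ∈ FInf A ι,
            sigMax A ι i z ≤ 0 ∧ sigMax A ι j z ≤ 0 ∧ Reach A ι i j z y := by
          intro k hk hpos
          obtain ⟨y', hy', rfl⟩ := ih m hmn hy hpos hym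
          have hlt := hym ▸ hheight k hy'
          obtain ⟨z, hz, h1, h2, h3⟩ := ihm _ hlt y' hy' rfl (hlt.trans hmn)
          exact ⟨z, hz, h1, h2, h3.step hk⟩
        by_cases h1 : 0 < sigMax A ι i y
        · exact hdown i (Or.inl rfl) h1
        by_cases h2 : 0 < sigMax A ι j y
        · exact hdown j (Or.inr rfl) h2
        exact ⟨y, hy, not_lt.mp h1, not_lt.mp h2, Reach.refl⟩
    obtain ⟨z, hz, h1, h2, h3⟩ := hdesc _ y hy rfl (hn ▸ hheight j hy)
    obtain ⟨y', h4, h5⟩ :=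
      (h3.step (Or.inr rfl)).exists_pred hι hdiag hoff hzero hij h1 h2 hi
    exact ⟨y', h4.mem_FInf hz, h5⟩

lemma sig_eq_apply {L : ℕ} (hx : ∀ k, L < k → x k = 0) : sig A ι L x = x L := by
  rw [sig_eq, tailSum_eq_zero _ _ fun j hj => hx j (by omega), add_zero]

lemma DemInf_subset (hι : ∀ i : S, {k : ℕ | 1 ≤ k ∧ ι k = i}.Infinite) {L : ℕ}
    (hx : x ∈ DemInf A ι L) : x ∈ FInf A ι ∧ ∀ k, L < k → x k = 0 := by
  induction L generalizing x with
  | zero =>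
    obtain rfl : x = 0 := hx
    exact ⟨zero_mem_FInf, fun _ _ => rfl⟩
  | succ L ih =>
    obtain ⟨m, y, hy, rfl⟩ := hx
    induction m with
    | zero =>
      obtain ⟨h1, h2⟩ := ih hy
      exact ⟨h1, fun k hk => h2 k (by omega)⟩
    | succ m ihm =>
      obtain ⟨h1, h2⟩ := ihm
      rw [Function.iterate_succ_apply']
      refine ⟨ftilInf_mem_FInf _ h1, fun k hk => ?_⟩
      obtain ⟨q, hq, e⟩ := exists_ftilInf_eq (A := A) hι (ι (L + 1)) _
      rw [e, Finsupp.add_apply, h2 k hk, zero_add, Finsupp.single_apply, if_neg]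
      rintro rfl
      have h3 := hq.first (L + 1) (by omega) hk rfl
      rw [sig_eq_apply h2, sig_of_large (N := L + 2) (fun j hj => h2 j (by omega)) hk] at h3
      exact absurd ((FInf_nonneg hι h1).2 (L + 1)) (not_le.mpr h3)

lemma mem_DemInf (hι : ∀ i : S, {k : ℕ | 1 ≤ k ∧ ι k = i}.Infinite)
    (hdiag : ∀ i, A i i = 2) (hoff : ∀ i j, i ≠ j → A i j ≤ 0)
    (hzero : ∀ i j, A i j = 0 ↔ A j i = 0) {L : ℕ} (hx : x ∈ FInf A ι)
    (hL : ∀ k, L < k → x k = 0) : x ∈ DemInf A ι L := by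
  induction L generalizing x with
  | zero =>
    refine Finsupp.ext fun k => ?_
    rcases Nat.eq_zero_or_pos k with rfl | hk
    · exact (FInf_nonneg hι hx).1
    · exact hL k hk
  | succ L ih =>
    induction hn : (height x).toNat using Nat.strong_induction_on generalizing x with
    | _ n ihn =>
      by_cases hpos : 0 < sigMax A ι (ι (L + 1)) x
      · obtain ⟨y, hy, rfl⟩ := FInf_exists_pred hι hdiag hoff hzero hx hpos
        have h1 := height_ftilInf (A := A) hι (ι (L + 1)) y
        have h2 := height_nonneg (FInf_nonneg hι hy).2
        obtain ⟨m, w, hw, rfl⟩ := ihn _ (by omega) hy (fun k hk => by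
          obtain ⟨q, -, e⟩ := exists_ftilInf_eq (A := A) hι (ι (L + 1)) y
          have h3 := hL k hk
          have h4 := (FInf_nonneg hι hy).2 k
          rw [e, Finsupp.add_apply, Finsupp.single_apply] at h3
          split_ifs at h3 <;> omega) rfl
        exact ⟨m + 1, w, hw, Function.iterate_succ_apply' _ _ _⟩
      · refine ⟨0, x, ih hx fun k hk => ?_, rfl⟩
        rcases Nat.lt_or_ge (L + 1) k with hlt | hge
        · exact hL k hlt
        · obtain rfl : k = L + 1 := by omega
          have h1 := sig_le_tailMax (A := A) hι (K := 1) x hk.pos rfl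
          rw [sig_eq_apply hL] at h1
          rw [sigMax_eq_tailMax] at hpos
          have := (FInf_nonneg hι hx).2 (L + 1)
          omega

end Polytope

/-- Let `w = s_{i_L}⋯s_{i_1}` be a reduced word whose letters are the first
`L` terms of `ι`. Then `D_L(∞) = { x ∈ F(∞) : x_k = 0 for all k > L }`, i.e. the image of the
crystal `B_w(∞)` under the Kashiwara embedding is cut out by the vanishing conditions. -/
theorem demazure_polytope_infinity {I : Type*} [Fintype I] [DecidableEq I]
    (A : I → I → ℤ)
    (hAdiag : ∀ i, A i i = 2)
    (hAoff : ∀ i j, i ≠ j → A i j ≤ 0)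
    (hAzero : ∀ i j, A i j = 0 ↔ A j i = 0)
    (hAsym : ∃ d : I → ℤ, (∀ i, 0 < d i) ∧ ∀ i j, d i * A i j = d j * A j i)
    (ι : ℕ → I)
    (hι₁ : ∀ k, 1 ≤ k → ι k ≠ ι (k + 1))
    (hι₂ : ∀ i : I, {k : ℕ | 1 ≤ k ∧ ι k = i}.Infinite)
    (L : ℕ)
    (hred : (coxOf A).toCoxeterSystem.IsReduced (demWord ι L)) :
    DemInf A ι L = {x ∈ FInf A ι | ∀ k, L < k → x k = 0} := by
  ext x
  exact ⟨DemInf_subset hι₂, fun hx => mem_DemInf hι₂ hAdiag hAoff hAzero hx.1 hx.2⟩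

end PaperNakashima
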